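/- There is a constant C' > 0 such that for all n and all integers ℓ with 42 ≤ ℓ ≤ n, every extension of P_cycl(ℓ,n) that is isometry-symmetric with respect to the group S_n (acting by permuting the nodes of K_n) has size at least C' · binomial(⌊n/3⌋, ⌊(⌊ℓ/6⌋ − 1)/2⌋); equivalently, whenever such a symmetric extension Q is described as the set of solutions of a system of linear equations and f linear inequalities, then f ≥ C' · binomial(⌊n/3⌋, ⌊(⌊ℓ/6⌋ − 1)/2⌋). -/

import Mathlib

open scoped BigOperators
open Classical in
noncomputable section

/-- Edges of the complete graph `K_n` on the node set `Fin n`. -/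
abbrev Edge (n : ℕ) := {e : Sym2 (Fin n) // ¬ e.IsDiag}

def edgeMap {n : ℕ} (π : Equiv.Perm (Fin n)) (e : Edge n) : Edge n :=
  ⟨Sym2.map π e.1, by rw [Sym2.isDiag_map (Equiv.injective π)]; exact e.2⟩

/-- Action of a node permutation on vectors indexed by edges:
`(π.x)_{{v,w}} = x_{{π⁻¹ v, π⁻¹ w}}`. -/
def edgeAction {n : ℕ} (π : Equiv.Perm (Fin n)) (x : Edge n → ℝ) : Edge n → ℝ :=
  fun e => x (edgeMap π⁻¹ e)

/-- Characteristic vector (on the edges of `K_n`) of the edge set of the simple cycle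
visiting the `ℓ` distinct nodes `f 0, f 1, …, f (ℓ-1)` in this cyclic order. -/
def cycleVec {n ℓ : ℕ} (f : Fin ℓ → Fin n) : Edge n → ℝ :=
  fun e =>
    if e.1 ∈ Finset.image (fun i : Fin ℓ => s(f i, f (finRotate ℓ i))) Finset.univ
    then 1 else 0

/-- `P_cycl(ℓ,n)`: convex hull of characteristic vectors of edge sets of length-`ℓ`
simple cycles in `K_n`. -/
def cyclePolytope (n ℓ : ℕ) : Set (Edge n → ℝ) :=
  convexHull ℝ {x | ∃ f : Fin ℓ → Fin n, Function.Injective f ∧ x = cycleVec f}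

/-! ### Part B: subgroups of small index of the symmetric group -/

/-- The three-cycle `a ↦ b ↦ c ↦ a`. -/
def cycThree {n : ℕ} (a b c : Fin n) : Equiv.Perm (Fin n) := Equiv.swap a b * Equiv.swap b c

lemma cycThree_apply {n : ℕ} {a b c : Fin n} (hab : a ≠ b) (hac : a ≠ c) (hbc : b ≠ c) (x : Fin n) :
    cycThree a b c x = if x = a then b else if x = b then c else if x = c then a else x := by
  unfold cycThree
  simp only [Equiv.Perm.mul_apply, Equiv.swap_apply_def]
  grind

lemma cycThree_conj {n : ℕ} (g : Equiv.Perm (Fin n)) (a b c : Fin n) :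
    g * cycThree a b c * g⁻¹ = cycThree (g a) (g b) (g c) := by
  unfold cycThree
  rw [Equiv.swap_apply_apply, Equiv.swap_apply_apply]
  group

lemma cycThree_inv {n : ℕ} (a b c : Fin n) : (cycThree a b c)⁻¹ = cycThree c b a := by
  unfold cycThree
  rw [mul_inv_rev, Equiv.swap_inv, Equiv.swap_inv, Equiv.swap_comm b c, Equiv.swap_comm a b]

lemma cycThree_rot {n : ℕ} {a b c : Fin n} (hab : a ≠ b) (hac : a ≠ c) (hbc : b ≠ c) :
    cycThree a b c = cycThree b c a := by
  ext x
  rw [cycThree_apply hab hac hbc, cycThree_apply hbc hab.symm hac.symm]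
  grind

/-- Two nodes are related if they lie in a common three-cycle of `G`. -/
def threeRel {n : ℕ} (G : Subgroup (Equiv.Perm (Fin n))) (a b : Fin n) : Prop :=
  a = b ∨ ∃ c, a ≠ b ∧ a ≠ c ∧ b ≠ c ∧ cycThree a b c ∈ G

lemma threeRel_symm {n : ℕ} {G : Subgroup (Equiv.Perm (Fin n))} {a b : Fin n}
    (h : threeRel G a b) : threeRel G b a := by
  rcases h with h | ⟨c, hab, hac, hbc, h⟩
  · exact Or.inl h.symm
  · refine Or.inr ⟨c, hab.symm, hbc, hac, ?_⟩
    have := G.inv_mem h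
    rw [cycThree_inv, cycThree_rot hbc.symm hac.symm hab.symm] at this
    exact this

lemma threeRel_trans {n : ℕ} {G : Subgroup (Equiv.Perm (Fin n))} {a b d : Fin n}
    (h : threeRel G a b) (h' : threeRel G b d) : threeRel G a d := by
  rcases h with h | ⟨c, hab, hac, hbc, h⟩
  · rw [h]; exact h'
  rcases h' with h' | ⟨e, hbd, hbe, hde, h'⟩
  · rw [← h']; exact Or.inr ⟨c, hab, hac, hbc, h⟩
  by_cases had : a = d
  · exact Or.inl had
  by_cases hae : a = e
  · subst hae
    refine threeRel_symm (Or.inr ⟨b, Ne.symm had, hbd.symm, hab, ?_⟩)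
    rw [← cycThree_rot hbd hbe hde]; exact h'
  · have hc := G.mul_mem (G.mul_mem h' h) (G.inv_mem h')
    rw [cycThree_conj] at hc
    have e1 : cycThree b d e a = a := by
      rw [cycThree_apply hbd hbe hde]; grind
    have e2 : cycThree b d e b = d := by
      rw [cycThree_apply hbd hbe hde]; grind
    rw [e1, e2] at hc
    refine Or.inr ⟨_, had, ?_, ?_, hc⟩
    · intro h0
      exact hac ((cycThree b d e).injective (e1.trans h0))
    · intro h0
      exact hbc ((cycThree b d e).injective (e2.trans h0))

lemma threeRel_map {n : ℕ} {G : Subgroup (Equiv.Perm (Fin n))} {g : Equiv.Perm (Fin n)} (hg : g ∈ G)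
    {a b : Fin n} (h : threeRel G a b) : threeRel G (g a) (g b) := by
  rcases h with h | ⟨c, hab, hac, hbc, h⟩
  · exact Or.inl (by rw [h])
  · refine Or.inr ⟨g c, g.injective.ne hab, g.injective.ne hac, g.injective.ne hbc, ?_⟩
    rw [← cycThree_conj]
    exact G.mul_mem (G.mul_mem hg h) (G.inv_mem hg)

/-- The setoid of `threeRel`. -/
def threeSetoid {n : ℕ} (G : Subgroup (Equiv.Perm (Fin n))) : Setoid (Fin n) where
  r := threeRel G
  iseqv := ⟨fun _ => Or.inl rfl, threeRel_symm, threeRel_trans⟩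

lemma cycThree_mem {n : ℕ} {G : Subgroup (Equiv.Perm (Fin n))} {a b c : Fin n}
    (hab : a ≠ b) (hac : a ≠ c) (hbc : b ≠ c)
    (h1 : threeRel G a b) (h2 : threeRel G a c) : cycThree a b c ∈ G := by
  have key : ∀ x, x ≠ a → x ≠ b → x ≠ c → cycThree a b x ∈ G → cycThree c b x ∈ G →
      cycThree a b c ∈ G := by
    intro x hxa hxb hxc k1 k2
    have k3 := G.mul_mem (G.mul_mem (G.inv_mem k2) k1) (G.inv_mem (G.inv_mem k2))
    rw [cycThree_conj, cycThree_inv] at k3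
    rw [cycThree_apply hxb hxc hbc, cycThree_apply hxb hxc hbc, cycThree_apply hxb hxc hbc] at k3
    have : cycThree a c b ∈ G := by
      convert k3 using 2 <;> grind
    have := G.inv_mem this
    rw [cycThree_inv, cycThree_rot hbc hab.symm hac.symm, cycThree_rot hac.symm hbc.symm hab] at this
    exact this
  rcases h1 with h1 | ⟨x, _, hax, hbx, h1⟩
  · exact absurd h1 hab
  rcases h2 with h2 | ⟨y, _, hay, hcy, h2⟩
  · exact absurd h2 hac
  by_cases hxc : x = c
  · rw [← hxc]; exact h1
  by_cases hyb : y = b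
  · subst hyb
    have := G.inv_mem h2
    rw [cycThree_inv, cycThree_rot hbc hab.symm hac.symm, cycThree_rot hac.symm hbc.symm hab] at this
    exact this
  have k3 := G.mul_mem (G.mul_mem h2 h1) (G.inv_mem h2)
  rw [cycThree_conj] at k3
  rw [cycThree_apply hac hay hcy, cycThree_apply hac hay hcy, cycThree_apply hac hay hcy] at k3
  by_cases hxy : x = y
  · subst hxy
    have : cycThree c b a ∈ G := by
      convert k3 using 2 <;> grind
    have := G.inv_mem this
    rw [cycThree_inv] at this
    exact this
  · have : cycThree c b x ∈ G := by
      convert k3 using 2 <;> grind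
    exact key x hax.symm hbx.symm hxc h1 this

lemma even_mem_of_class {n : ℕ} {G : Subgroup (Equiv.Perm (Fin n))} (W : Finset (Fin n))
    (hW : ∀ a ∈ W, ∀ b ∈ W, threeRel G a b) (τ : Equiv.Perm (Fin n))
    (hτ : ∀ x, x ∉ W → τ x = x) (hs : Equiv.Perm.sign τ = 1) : τ ∈ G := by
  have hp : ∀ x, τ x ≠ x → x ∈ W := fun x hx => by
    by_contra h; exact hx (hτ x h)
  have hp' : ∀ x, τ x ∈ W ↔ x ∈ W := by
    intro x
    by_cases h : τ x = x
    · rw [h]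
    · exact ⟨fun _ => hp x h, fun _ => hp _ (fun h' => h (τ.injective h'))⟩
  have e := Equiv.Perm.ofSubtype_subtypePerm (p := fun x => x ∈ W) hp' hp
  have hsub : τ.subtypePerm hp' ∈ alternatingGroup {x // x ∈ W} := by
    rw [Equiv.Perm.mem_alternatingGroup, ← Equiv.Perm.sign_ofSubtype, e, hs]
  rw [← Equiv.Perm.closure_three_cycles_eq_alternating] at hsub
  have : Subgroup.closure {σ : Equiv.Perm {x // x ∈ W} | σ.IsThreeCycle} ≤
      G.comap (Equiv.Perm.ofSubtype) := by
    rw [Subgroup.closure_le]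
    intro σ hσ
    obtain ⟨a, ha⟩ := hσ.isCycle
    have h3 := hσ.orderOf
    have hne : σ a ≠ a := ha.1
    have hne2 : σ (σ a) ≠ a := by
      intro h
      have : σ ^ 3 = 1 := by rw [← h3]; exact pow_orderOf_eq_one σ
      have := congrArg (fun g => g a) this
      simp [pow_succ, h] at this
      exact hne this
    have hne3 : σ (σ a) ≠ σ a := fun h => hne (σ.injective h)
    have h33 : σ (σ (σ a)) = a := by
      have : σ ^ 3 = 1 := by rw [← h3]; exact pow_orderOf_eq_one σ
      have := congrArg (fun g => g a) this
      simpa [pow_succ] using this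
    have hab : (a : Fin n) ≠ σ a := fun h => hne (Subtype.ext h.symm)
    have hac : (a : Fin n) ≠ σ (σ a) := fun h => hne2 (Subtype.ext h.symm)
    have hbc : (σ a : Fin n) ≠ σ (σ a) := fun h => hne3 (Subtype.ext h.symm)
    have hm := cycThree_mem hab hac hbc (hW _ a.2 _ (σ a).2) (hW _ a.2 _ (σ (σ a)).2)
    have : Equiv.Perm.ofSubtype σ = cycThree (a : Fin n) (σ a) (σ (σ a)) := by
      ext x
      rw [cycThree_apply hab hac hbc]
      by_cases hx : x ∈ W
      · rw [Equiv.Perm.ofSubtype_apply_of_mem σ hx]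
        split_ifs with h1 h2 h3
        · have : (⟨x, hx⟩ : {x // x ∈ W}) = a := Subtype.ext h1
          rw [this]
        · have : (⟨x, hx⟩ : {x // x ∈ W}) = σ a := Subtype.ext h2
          rw [this]
        · have : (⟨x, hx⟩ : {x // x ∈ W}) = σ (σ a) := Subtype.ext h3
          rw [this, h33]
        · by_contra hmv
          have hmv' : σ ⟨x, hx⟩ ≠ ⟨x, hx⟩ := fun h => hmv (by rw [h])
          have hsup : σ.support = {a, σ a, σ (σ a)} := by
            symm
            apply Finset.eq_of_subset_of_card_le
            · intro z hz
              simp only [Finset.mem_insert, Finset.mem_singleton] at hz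
              rw [Equiv.Perm.mem_support]
              rcases hz with rfl | rfl | rfl
              · exact hne
              · exact hne3
              · rw [h33]; exact hne2.symm
            · rw [hσ.card_support]
              rw [Finset.card_eq_three.2 ⟨a, σ a, σ (σ a), hne.symm, hne2.symm, hne3.symm, rfl⟩]
          have := (Equiv.Perm.mem_support).2 hmv'
          rw [hsup] at this
          simp only [Finset.mem_insert, Finset.mem_singleton] at this
          rcases this with h | h | h
          · exact h1 (congrArg Subtype.val h)
          · exact h2 (congrArg Subtype.val h)
          · exact h3 (congrArg Subtype.val h)
      · rw [Equiv.Perm.ofSubtype_apply_of_not_mem σ hx]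
        have m1 : x ≠ a := fun h => hx (h ▸ a.2)
        have m2 : x ≠ σ a := fun h => hx (h ▸ (σ a).2)
        have m3 : x ≠ σ (σ a) := fun h => hx (h ▸ (σ (σ a)).2)
        simp [m1, m2, m3]
    show Equiv.Perm.ofSubtype σ ∈ G
    rw [this]; exact hm
  have := this hsub
  rw [Subgroup.mem_comap, e] at this
  exact this

lemma perm_apply_inv {α : Type*} (g : Equiv.Perm α) (x : α) : g (g⁻¹ x) = x := by simp

lemma perm_inv_apply {α : Type*} (g : Equiv.Perm α) (x : α) : g⁻¹ (g x) = x := by simp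

/-- `D` is a base for `G`. -/
def isBase {n : ℕ} (G : Subgroup (Equiv.Perm (Fin n))) (D : Finset (Fin n)) : Prop :=
  ∀ g ∈ G, (∀ x ∈ D, g x = x) → g = 1

lemma commutator_eq_cycThree {n : ℕ} (x y : Equiv.Perm (Fin n)) (D : Finset (Fin n)) (δ : Fin n)
    (hδ : δ ∈ D) (hx : ∀ z, z ∉ D → x z = z) (hxδ : x δ ≠ δ)
    (hy : ∀ z ∈ D, z ≠ δ → y z = z) (hyδ : y δ ≠ δ) :
    y δ ∉ D ∧ x * y * x⁻¹ * y⁻¹ = cycThree δ (x δ) (y δ) := by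
  have hyD : y δ ∉ D := by
    intro h
    exact hyδ (y.injective (hy _ h hyδ))
  refine ⟨hyD, ?_⟩
  have hxD : ∀ z ∈ D, x z ∈ D := by
    intro z hz
    by_contra h
    have := hx _ h
    exact h ((x.injective this).symm ▸ hz)
  have hxiD : ∀ z ∈ D, x⁻¹ z ∈ D := by
    intro z hz
    by_contra h
    have := hx _ h
    rw [perm_apply_inv] at this
    exact h (this ▸ hz)
  have hxi : ∀ z, z ∉ D → x⁻¹ z = z := fun z hz => by
    rw [Equiv.Perm.inv_eq_iff_eq]; exact (hx z hz).symm
  have hyi : ∀ z ∈ D, z ≠ δ → y⁻¹ z = z := fun z hz h => by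
    rw [Equiv.Perm.inv_eq_iff_eq]; exact (hy z hz h).symm
  have d2 : δ ≠ y δ := hyδ.symm
  have d3 : x δ ≠ y δ := fun h => hyD (h ▸ hxD _ hδ)
  ext z
  rw [cycThree_apply hxδ.symm d2 d3]
  simp only [Equiv.Perm.mul_apply]
  congr 1
  by_cases h1 : z = δ
  · subst h1
    have hz : y⁻¹ z ∉ D := by
      intro h
      by_cases h' : y⁻¹ z = z
      · exact hyδ (by rw [Equiv.Perm.inv_eq_iff_eq] at h'; exact h'.symm)
      · have := hy _ h h'
        rw [perm_apply_inv] at this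
        exact h' this.symm
    rw [hxi _ hz]; simp
  rw [if_neg h1]
  by_cases h2 : z = x δ
  · rw [if_pos h2, h2, hyi _ (hxD _ hδ) hxδ, perm_inv_apply, hx _ hyD]
  rw [if_neg h2]
  by_cases h3 : z = y δ
  · rw [if_pos h3, h3, perm_inv_apply, hy _ (hxiD _ hδ), perm_apply_inv]
    intro h; rw [Equiv.Perm.inv_eq_iff_eq] at h; exact hxδ h.symm
  rw [if_neg h3]
  by_cases hzD : z ∈ D
  · rw [hyi _ hzD h1, hy _ (hxiD _ hzD), perm_apply_inv]
    intro h; rw [Equiv.Perm.inv_eq_iff_eq] at h; exact h2 h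
  · have hz : y⁻¹ z ∉ D := by
      intro h
      by_cases h' : y⁻¹ z = δ
      · rw [Equiv.Perm.inv_eq_iff_eq] at h'; exact h3 h'
      · have := hy _ h h'
        rw [perm_apply_inv] at this
        exact hzD (this ▸ h)
    rw [hxi _ hz, perm_apply_inv, hx _ hzD]

lemma card_le_of_base {n : ℕ} (G : Subgroup (Equiv.Perm (Fin n))) (D : Finset (Fin n))
    (hD : isBase G D) : (n - D.card).factorial ≤ G.index := by
  classical
  have h1 : Nat.card G ≤ n.descFactorial D.card := by
    have : Function.Injective (fun (g : G) =>
        (⟨fun x : D => g.1 x, fun a b h => Subtype.ext (g.1.injective h)⟩ : D ↪ Fin n)) := by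
      intro g h hgh
      have hgh' : ∀ x ∈ D, g.1 x = h.1 x := fun x hx =>
        congrArg (fun (e : D ↪ Fin n) => e ⟨x, hx⟩) hgh
      have := hD (h.1⁻¹ * g.1) (G.mul_mem (G.inv_mem h.2) g.2) (by
        intro x hx
        simp [hgh' x hx])
      apply Subtype.ext
      exact (inv_mul_eq_one.1 this).symm
    have := Nat.card_le_card_of_injective _ this
    rwa [Nat.card_eq_fintype_card (α := D ↪ Fin n), Fintype.card_embedding_eq, Fintype.card_fin,
      Fintype.card_coe] at this
  have h2 := G.card_mul_index
  rw [Nat.card_eq_fintype_card (α := Equiv.Perm (Fin n)), Fintype.card_perm, Fintype.card_fin] at h2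
  have hle : D.card ≤ n := by simpa using D.card_le_univ
  have h3 := Nat.factorial_mul_descFactorial hle
  have hpos : 0 < n.descFactorial D.card := Nat.descFactorial_pos.2 hle
  have : (n - D.card).factorial * n.descFactorial D.card ≤ G.index * n.descFactorial D.card := by
    rw [h3, ← h2, mul_comm]
    exact Nat.mul_le_mul_left _ h1
  exact Nat.le_of_mul_le_mul_right this hpos

/-- A base of minimal size, and the bound on the number of classes. -/
lemma exists_few_classes {n : ℕ} (G : Subgroup (Equiv.Perm (Fin n))) :
    ∃ e : ℕ, e.factorial ≤ G.index ∧ Nat.card (Quotient (threeSetoid G)) ≤ 2 * e := by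
  classical
  have hex : ∃ c, ∃ D : Finset (Fin n), isBase G D ∧ D.card = c :=
    ⟨_, Finset.univ, fun g _ h => Equiv.ext fun x => h x (Finset.mem_univ x), rfl⟩
  obtain ⟨D, hD, hDc⟩ := Nat.find_spec hex
  have hmin : ∀ D' : Finset (Fin n), D'.card < D.card → ¬ isBase G D' := by
    intro D' h hb
    exact Nat.find_min hex (hDc ▸ h) ⟨D', hb, rfl⟩
  have htrans : ∀ Θ : Finset (Fin n), Θ ⊆ D → (∀ a ∈ Θ, ∀ b ∈ Θ, threeRel G a b → a = b) →
      Θ.card ≤ n - D.card := by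
    intro Θ hΘ hind
    by_contra hlt
    have hc : (Finset.univ \ Θ).card < D.card := by
      rw [Finset.card_sdiff_of_subset (Finset.subset_univ _), Finset.card_univ, Fintype.card_fin]
      have := Finset.card_le_card hΘ
      omega
    have hnb := hmin _ hc
    unfold isBase at hnb
    push Not at hnb
    obtain ⟨x, hxG, hx, hx1⟩ := hnb
    obtain ⟨δ, hδ⟩ : ∃ δ, x δ ≠ δ := by
      by_contra h
      push Not at h
      exact hx1 (Equiv.ext h)
    have hx' : ∀ z, z ∉ Θ → x z = z := fun z hz => hx z (by simp [hz])
    have hδΘ : δ ∈ Θ := by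
      by_contra h; exact hδ (hx' _ h)
    have hnb2 := hmin (D.erase δ) (Finset.card_erase_lt_of_mem (hΘ hδΘ))
    unfold isBase at hnb2
    push Not at hnb2
    obtain ⟨y, hyG, hy, hy1⟩ := hnb2
    have hyδ : y δ ≠ δ := by
      intro h
      apply hy1
      apply hD y hyG
      intro z hz
      by_cases hzδ : z = δ
      · rw [hzδ, h]
      · exact hy z (Finset.mem_erase.2 ⟨hzδ, hz⟩)
    obtain ⟨hyD, hcom⟩ := commutator_eq_cycThree x y D δ (hΘ hδΘ)
      (fun z hz => hx' z (fun h => hz (hΘ h))) hδ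
      (fun z hz hzδ => hy z (Finset.mem_erase.2 ⟨hzδ, hz⟩)) hyδ
    have hxδΘ : x δ ∈ Θ := by
      by_contra h
      have := hx' _ h
      exact hδ (x.injective this)
    have hmem : cycThree δ (x δ) (y δ) ∈ G := by
      rw [← hcom]
      exact G.mul_mem (G.mul_mem (G.mul_mem hxG hyG) (G.inv_mem hxG)) (G.inv_mem hyG)
    exact hδ (hind δ hδΘ (x δ) hxδΘ
      (Or.inr ⟨_, hδ.symm, hyδ.symm, fun h => hyD (h ▸ hΘ hxδΘ), hmem⟩)).symm
  refine ⟨n - D.card, card_le_of_base G D hD, ?_⟩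
  let out : Quotient (threeSetoid G) → Fin n := Quotient.out
  have hinj : Function.Injective out := Quotient.out_injective
  have : Fintype (Quotient (threeSetoid G)) := Fintype.ofFinite _
  let T : Finset (Fin n) := Finset.univ.image out
  have hT : T.card = Nat.card (Quotient (threeSetoid G)) := by
    rw [Finset.card_image_of_injective _ hinj, Finset.card_univ, Nat.card_eq_fintype_card]
  have h1 : (T ∩ D).card ≤ n - D.card := by
    apply htrans _ Finset.inter_subset_right
    intro a ha b hb hab
    obtain ⟨qa, _, rfl⟩ := Finset.mem_image.1 (Finset.mem_inter.1 ha).1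
    obtain ⟨qb, _, rfl⟩ := Finset.mem_image.1 (Finset.mem_inter.1 hb).1
    have : (⟦out qa⟧ : Quotient (threeSetoid G)) = ⟦out qb⟧ := Quotient.sound hab
    rw [show (⟦out qa⟧ : Quotient (threeSetoid G)) = qa from Quotient.out_eq qa,
      show (⟦out qb⟧ : Quotient (threeSetoid G)) = qb from Quotient.out_eq qb] at this
    rw [this]
  have h2 : (T \ D).card ≤ n - D.card := by
    calc (T \ D).card ≤ (Finset.univ \ D).card :=
          Finset.card_le_card (Finset.sdiff_subset_sdiff (Finset.subset_univ _) subset_rfl)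
      _ = n - D.card := by
        rw [Finset.card_sdiff_of_subset (Finset.subset_univ _), Finset.card_univ, Fintype.card_fin]
  have h3 := Finset.card_inter_add_card_sdiff T D
  omega

lemma exists_perm_image {n : ℕ} (S S' : Finset (Fin n)) (h : S.card = S'.card) :
    ∃ π : Equiv.Perm (Fin n), S.image π = S' := by
  classical
  let e : {x // x ∈ S} ≃ {x // x ∈ S'} := Fintype.equivOfCardEq (by simpa using h)
  refine ⟨e.extendSubtype, ?_⟩
  apply Finset.eq_of_subset_of_card_le
  · intro y hy
    obtain ⟨x, hx, rfl⟩ := Finset.mem_image.1 hy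
    exact e.extendSubtype_mem x hx
  · rw [Finset.card_image_of_injective _ (Equiv.injective _), h]

lemma choose_le_index_mul {n : ℕ} (G : Subgroup (Equiv.Perm (Fin n))) (S : Finset (Fin n))
    (𝒰 : Finset (Finset (Fin n))) (h𝒰 : ∀ g ∈ G, S.image g ∈ 𝒰) :
    n.choose S.card ≤ G.index * 𝒰.card := by
  classical
  have hperm : ∀ S' : Finset (Fin n), ∃ π : Equiv.Perm (Fin n), S'.card = S.card → S.image π = S' := by
    intro S'
    by_cases h : S'.card = S.card
    · obtain ⟨π, hπ⟩ := exists_perm_image S S' h.symm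
      exact ⟨π, fun _ => hπ⟩
    · exact ⟨1, fun h' => absurd h' h⟩
  choose π hπ using hperm
  let P := Finset.powersetCard S.card (Finset.univ : Finset (Fin n))
  have hP : P.card = n.choose S.card := by
    rw [Finset.card_powersetCard, Finset.card_univ, Fintype.card_fin]
  let F : Finset (Fin n) → (Equiv.Perm (Fin n) ⧸ G) × Finset (Fin n) := fun S' =>
    ((π S' : Equiv.Perm (Fin n) ⧸ G),
      S'.image ((Quotient.out (π S' : Equiv.Perm (Fin n) ⧸ G))⁻¹ : Equiv.Perm (Fin n)))
  have : Fintype (Equiv.Perm (Fin n) ⧸ G) := Fintype.ofFinite _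
  have hmaps : ∀ S' ∈ P, F S' ∈ (Finset.univ : Finset (Equiv.Perm (Fin n) ⧸ G)) ×ˢ 𝒰 := by
    intro S' hS'
    rw [Finset.mem_product]
    refine ⟨Finset.mem_univ _, ?_⟩
    have hc : S'.card = S.card := (Finset.mem_powersetCard.1 hS').2
    have hg : ((Quotient.out (π S' : Equiv.Perm (Fin n) ⧸ G))⁻¹ * π S' : Equiv.Perm (Fin n)) ∈ G := by
      rw [← QuotientGroup.eq]
      exact Quotient.out_eq _
    have := h𝒰 _ hg
    have e : S'.image ((Quotient.out (π S' : Equiv.Perm (Fin n) ⧸ G))⁻¹ : Equiv.Perm (Fin n)) =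
        S.image ((Quotient.out (π S' : Equiv.Perm (Fin n) ⧸ G))⁻¹ * π S' : Equiv.Perm (Fin n)) := by
      have e2 : ∀ q : Equiv.Perm (Fin n), S'.image q = S.image (q * π S' : Equiv.Perm (Fin n)) := by
        intro q
        conv_lhs => rw [← hπ S' hc]
        rw [Finset.image_image]; rfl
      exact e2 _
    show S'.image _ ∈ 𝒰
    rw [e]; exact this
  have hinj : Set.InjOn F P := by
    intro A _ B _ hAB
    have h1 : (π A : Equiv.Perm (Fin n) ⧸ G) = π B := congrArg Prod.fst hAB
    have h2 : A.image ((Quotient.out (π A : Equiv.Perm (Fin n) ⧸ G))⁻¹ : Equiv.Perm (Fin n)) =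
      B.image ((Quotient.out (π B : Equiv.Perm (Fin n) ⧸ G))⁻¹ : Equiv.Perm (Fin n)) :=
        congrArg Prod.snd hAB
    rw [h1] at h2
    exact Finset.image_injective (Equiv.injective _) h2
  have := Finset.card_le_card_of_injOn F hmaps hinj
  rw [hP, Finset.card_product, Finset.card_univ, ← Nat.card_eq_fintype_card] at this
  exact this

lemma arith_aux1 (q : ℕ) (hq : 10 ≤ q) : 20 * (q + 1) ≤ 2 ^ q := by
  induction q, hq using Nat.le_induction with
  | base => norm_num
  | succ q hq ih => rw [pow_succ]; omega

lemma arith_contra (n e σ idx : ℕ) (hn : 40000 ≤ n) (h1 : e.factorial ≤ idx)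
    (h2 : idx < 2 ^ (n / 3)) (h3 : n.choose σ ≤ idx * 2 ^ (2 * e)) (h4 : n ≤ 4 * σ)
    (h5 : 2 * σ ≤ n) : False := by
  have he : 20 * e < n := by
    by_contra h
    push Not at h
    obtain ⟨r, hr⟩ : ∃ r, e = 255 + r := ⟨e - 255, by omega⟩
    have hf := Nat.factorial_mul_pow_le_factorial (m := 255) (n := r)
    rw [← hr] at hf
    have hf2 : (2 ^ 8) ^ r ≤ (Nat.factorial 255) * (255 + 1) ^ r := by
      have : 1 ≤ Nat.factorial 255 := Nat.factorial_pos _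
      calc (2 ^ 8) ^ r = 1 * (255 + 1) ^ r := by norm_num
        _ ≤ _ := Nat.mul_le_mul_right _ this
    have : (2 : ℕ) ^ (8 * r) < 2 ^ (n / 3) := by
      rw [pow_mul]
      exact lt_of_le_of_lt (hf2.trans (hf.trans h1)) h2
    have := (Nat.pow_lt_pow_iff_right (by norm_num : 1 < 2)).1 this
    omega
  have hσ : 4 ≤ σ := by omega
  have hc := Nat.four_pow_lt_mul_centralBinom σ hσ
  have hcb : σ.centralBinom ≤ n.choose σ := by
    rw [Nat.centralBinom_eq_two_mul_choose]
    exact Nat.choose_le_choose σ h5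
  have hσn : σ ≤ 2 ^ (n / 20) := by
    have := arith_aux1 (n / 20) (by omega)
    omega
  have hfin : (2 : ℕ) ^ (2 * σ) < 2 ^ (n / 20 + (n / 3 + 2 * e)) := by
    rw [pow_mul, pow_add, pow_add]
    calc (2 ^ 2) ^ σ = 4 ^ σ := by norm_num
      _ < σ * σ.centralBinom := hc
      _ ≤ 2 ^ (n / 20) * (2 ^ (n / 3) * 2 ^ (2 * e)) := by
        apply Nat.mul_le_mul hσn
        exact hcb.trans (h3.trans (Nat.mul_le_mul_right _ h2.le))
  have := (Nat.pow_lt_pow_iff_right (by norm_num : 1 < 2)).1 hfin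
  omega

lemma choose_mono_half (n k t : ℕ) (hkt : k ≤ t) (ht : 2 * t ≤ n) : n.choose k ≤ n.choose t := by
  induction t, hkt using Nat.le_induction with
  | base => exact le_rfl
  | succ t hkt ih =>
    exact (ih (by omega)).trans (Nat.choose_le_succ_of_lt_half_left (by omega))

theorem small_index {n k : ℕ} (hn : 40000 ≤ n) (hk : 12 * k ≤ n)
    (G : Subgroup (Equiv.Perm (Fin n))) (hG : G.index < (n / 3).choose k) :
    ∃ V : Finset (Fin n), V.card ≤ k ∧
      ∀ τ : Equiv.Perm (Fin n), (∀ x ∈ V, τ x = x) → Equiv.Perm.sign τ = 1 → τ ∈ G := by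
  classical
  have : Fintype (Quotient (threeSetoid G)) := Fintype.ofFinite _
  let mk : Fin n → Quotient (threeSetoid G) := fun x => Quotient.mk (threeSetoid G) x
  let U : Finset (Quotient (threeSetoid G)) → Finset (Fin n) :=
    fun C => Finset.univ.filter (fun x => mk x ∈ C)
  have hmk : ∀ x y, mk x = mk y ↔ threeRel G x y := fun x y => Quotient.eq (r := threeSetoid G)
  have hUim : ∀ C, ∀ g ∈ G, ∃ C', (U C).image g = U C' := by
    intro C g hg
    refine ⟨((U C).image g).image mk, ?_⟩
    ext x
    simp only [U, Finset.mem_filter, Finset.mem_univ, true_and, Finset.mem_image]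
    constructor
    · rintro ⟨y, hy, rfl⟩
      exact ⟨g y, ⟨y, hy, rfl⟩, rfl⟩
    · rintro ⟨z, ⟨y, hy, rfl⟩, hz⟩
      refine ⟨g⁻¹ x, ?_, perm_apply_inv g x⟩
      have := threeRel_map (G.inv_mem hg) ((hmk _ _).1 hz)
      rw [perm_inv_apply] at this
      rw [← (hmk _ _).2 this]; exact hy
  by_cases hbig : ∃ q, n < 2 * (U {q}).card
  · obtain ⟨q, hq⟩ := hbig
    have hfix : ∀ g ∈ G, (U {q}).image g ∈ ({U {q}} : Finset (Finset (Fin n))) := by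
      intro g hg
      rw [Finset.mem_singleton]
      have hcard : ((U {q}).image g).card = (U {q}).card :=
        Finset.card_image_of_injective _ g.injective
      have hne : ((U {q}) ∩ (U {q}).image g).Nonempty := by
        rw [← Finset.card_pos]
        have h1 := Finset.card_union_add_card_inter (U {q}) ((U {q}).image g)
        have h2 : (U {q} ∪ (U {q}).image g).card ≤ n := by
          simpa using Finset.card_le_univ (U {q} ∪ (U {q}).image g)
        omega
      obtain ⟨z, hz⟩ := hne
      rw [Finset.mem_inter, Finset.mem_image] at hz
      obtain ⟨hz1, y, hy, rfl⟩ := hz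
      apply Finset.eq_of_subset_of_card_le
      · intro w hw
        obtain ⟨v, hv, rfl⟩ := Finset.mem_image.1 hw
        simp only [U, Finset.mem_filter, Finset.mem_univ, true_and, Finset.mem_singleton] at *
        rw [← hz1, hmk]
        apply threeRel_map hg
        rw [← hmk, hv, hy]
      · rw [hcard]
    have h1 := choose_le_index_mul G (U {q}) _ hfix
    rw [Finset.card_singleton, mul_one] at h1
    have hle : (U {q}).card ≤ n := by simpa using Finset.card_le_univ (U {q})
    rw [← Nat.choose_symm hle] at h1
    have hVc : ((U {q})ᶜ).card = n - (U {q}).card := by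
      rw [Finset.card_compl, Fintype.card_fin]
    refine ⟨(U {q})ᶜ, ?_, ?_⟩
    · rw [hVc]
      by_contra hlt
      push Not at hlt
      have a1 := choose_mono_half n k (n - (U {q}).card) hlt.le (by omega)
      have a2 := Nat.choose_le_choose k (Nat.div_le_self n 3)
      omega
    · intro τ hτ hs
      apply even_mem_of_class (U {q}) _ τ (fun x hx => hτ x (Finset.mem_compl.2 hx)) hs
      intro a ha b hb
      simp only [U, Finset.mem_filter, Finset.mem_univ, true_and, Finset.mem_singleton] at ha hb
      rw [← hmk, ha, hb]
  · exfalso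
    push Not at hbig
    obtain ⟨e, he, hr⟩ := exists_few_classes G
    obtain ⟨C, hC, hmax⟩ := Finset.exists_max_image
      ((Finset.univ : Finset (Finset (Quotient (threeSetoid G)))).filter
        (fun C => 2 * (U C).card ≤ n)) (fun C => (U C).card)
      ⟨∅, by simp [U]⟩
    rw [Finset.mem_filter] at hC
    have hC2 := hC.2
    have h4 : n ≤ 4 * (U C).card := by
      by_contra hlt
      push Not at hlt
      obtain ⟨x, hx⟩ : ∃ x, x ∉ U C := by
        by_contra h
        push Not at h
        have : U C = Finset.univ := Finset.eq_univ_iff_forall.2 h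
        rw [this, Finset.card_univ, Fintype.card_fin] at hlt
        omega
      have hxC : mk x ∉ C := by simpa [U] using hx
      have hun : U (insert (mk x) C) = U {mk x} ∪ U C := by
        ext y; simp [U]
      have hdisj : (U (insert (mk x) C)).card ≤ (U {mk x}).card + (U C).card := by
        rw [hun]; exact Finset.card_union_le _ _
      have hgt : (U C).card < (U (insert (mk x) C)).card := by
        apply Finset.card_lt_card
        rw [hun]
        refine ⟨Finset.subset_union_right, fun h => hx (h (Finset.mem_union_left _ ?_))⟩
        simp [U]
      have hb : n < 2 * (U (insert (mk x) C)).card := by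
        by_contra hh
        have := hmax _ (Finset.mem_filter.2 ⟨Finset.mem_univ (insert (mk x) C), by omega⟩)
        omega
      have := hmax {mk x} (Finset.mem_filter.2 ⟨Finset.mem_univ _, hbig _⟩)
      omega
    have h1 := choose_le_index_mul G (U C) (Finset.univ.image U) (by
      intro g hg
      obtain ⟨C', hC'⟩ := hUim C g hg
      rw [hC']
      exact Finset.mem_image_of_mem _ (Finset.mem_univ _))
    have hUc : (Finset.univ.image U).card ≤ 2 ^ (2 * e) := by
      refine Finset.card_image_le.trans ?_
      rw [Finset.card_univ, Fintype.card_finset]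
      apply Nat.pow_le_pow_right (by norm_num)
      rw [← Nat.card_eq_fintype_card]; exact hr
    exact arith_contra n e (U C).card G.index hn he
      (lt_of_lt_of_le hG (Nat.choose_le_two_pow _ _))
      (h1.trans (Nat.mul_le_mul_left _ hUc)) h4 hC2

/-! ### Part A: from symmetric extensions to symmetric slack functions -/

lemma aff_comb {d : ℕ} (σ : (Fin d → ℝ) →ᵃ[ℝ] ℝ) (c : ℝ) (a b x : Fin d → ℝ) :
    σ (c • (a - b) + x) = c * (σ a - σ b) + σ x := by
  have h1 := σ.map_vadd x (c • (a - b))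
  have h2 := σ.linearMap_vsub a b
  simp only [vadd_eq_add, vsub_eq_sub] at h1 h2
  rw [h1, map_smul, h2, smul_eq_mul]

lemma aff_comb_mem {d : ℕ} (S : AffineSubspace ℝ (Fin d → ℝ)) (c : ℝ) {a b x : Fin d → ℝ}
    (ha : a ∈ S) (hb : b ∈ S) (hx : x ∈ S) : c • (a - b) + x ∈ S := by
  have := S.smul_vsub_vadd_mem c ha hb hx
  simpa using this

/-- An irredundant inequality description of `Q` inside its affine hull. -/
structure IrredSys {d : ℕ} {ι : Type} (Q : Set (Fin d → ℝ)) (σ : ι → (Fin d → ℝ) →ᵃ[ℝ] ℝ) : Prop where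
  mem_iff : ∀ y, y ∈ Q ↔ y ∈ affineSpan ℝ Q ∧ ∀ i, 0 ≤ σ i y
  viol : ∀ i, ∃ v ∈ affineSpan ℝ Q, σ i v < 0 ∧ ∀ j, j ≠ i → 0 ≤ σ j v
  pos : ∀ i, ∃ q ∈ Q, 0 < σ i q

lemma exists_irred {d f : ℕ} (Q : Set (Fin d → ℝ)) (σ : Fin f → (Fin d → ℝ) →ᵃ[ℝ] ℝ)
    (hQ : ∀ y, y ∈ Q ↔ y ∈ affineSpan ℝ Q ∧ ∀ i, 0 ≤ σ i y) :
    ∃ I : Finset (Fin f), IrredSys Q (fun i : {i // i ∈ I} => σ i) := by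
  classical
  obtain ⟨I, hI, hmin⟩ := Finset.exists_min_image
    ((Finset.univ : Finset (Finset (Fin f))).filter
      (fun I => ∀ y, y ∈ Q ↔ y ∈ affineSpan ℝ Q ∧ ∀ i ∈ I, 0 ≤ σ i y)) Finset.card
    ⟨Finset.univ, by simpa using hQ⟩
  rw [Finset.mem_filter] at hI
  have hI := hI.2
  have hviol : ∀ i ∈ I, ∃ v ∈ affineSpan ℝ Q, σ i v < 0 ∧ ∀ j ∈ I, j ≠ i → 0 ≤ σ j v := by
    intro i hi
    by_contra hcon
    push Not at hcon
    have : I.card ≤ (I.erase i).card := by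
      apply hmin
      rw [Finset.mem_filter]
      refine ⟨Finset.mem_univ _, fun y => ⟨fun h => ?_, fun h => ?_⟩⟩
      · exact ⟨((hI y).1 h).1, fun j hj => ((hI y).1 h).2 j (Finset.mem_of_mem_erase hj)⟩
      · rw [hI]
        refine ⟨h.1, fun j hj => ?_⟩
        by_cases hji : j = i
        · subst hji
          by_contra hneg
          push Not at hneg
          obtain ⟨k, hk, hkj, hlt⟩ := hcon y h.1 hneg
          exact absurd (h.2 k (Finset.mem_erase.2 ⟨hkj, hk⟩)) (not_le.2 hlt)
        · exact h.2 j (Finset.mem_erase.2 ⟨hji, hj⟩)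
    have := Finset.card_erase_lt_of_mem hi
    omega
  refine ⟨I, ⟨?_, ?_, ?_⟩⟩
  · intro y
    rw [hI]; simp
  · rintro ⟨i, hi⟩
    obtain ⟨v, hv, h1, h2⟩ := hviol i hi
    exact ⟨v, hv, h1, fun j hj => h2 j j.2 (fun h => hj (Subtype.ext h))⟩
  · rintro ⟨i, hi⟩
    by_contra hcon
    push Not at hcon
    have hz : ∀ y ∈ Q, σ i y = 0 := fun y hy =>
      le_antisymm (hcon y hy) (((hI y).1 hy).2 i hi)
    obtain ⟨v, hv, h1, _⟩ := hviol i hi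
    have : affineSpan ℝ Q ≤ (affineSpan ℝ ({0} : Set ℝ)).comap (σ i) := by
      rw [affineSpan_le]
      intro y hy
      show σ i y ∈ affineSpan ℝ ({0} : Set ℝ)
      rw [hz y hy]
      exact mem_affineSpan ℝ rfl
    have := this hv
    have h0 : σ i v ∈ affineSpan ℝ ({0} : Set ℝ) := this
    rw [AffineSubspace.mem_affineSpan_singleton] at h0
    linarith

section irred
variable {d : ℕ} {ι : Type} {Q : Set (Fin d → ℝ)} {σ : ι → (Fin d → ℝ) →ᵃ[ℝ] ℝ}

lemma IrredSys.comb_mem (h : IrredSys Q σ) {a b : Fin d → ℝ} (ha : a ∈ Q) (hb : b ∈ Q) {c : ℝ}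
    (h0 : 0 ≤ c) (h1 : c ≤ 1) : c • (a - b) + b ∈ Q := by
  rw [h.mem_iff] at ha hb ⊢
  refine ⟨aff_comb_mem _ c ha.1 hb.1 hb.1, fun i => ?_⟩
  rw [aff_comb]
  have := ha.2 i
  have := hb.2 i
  nlinarith

lemma IrredSys.exists_interior [Fintype ι] [Nonempty ι] (h : IrredSys Q σ) :
    ∃ y ∈ Q, ∀ i, 0 < σ i y := by
  classical
  have : ∀ S : Finset ι, ∃ y ∈ Q, ∀ i ∈ S, 0 < σ i y := by
    intro S
    induction S using Finset.induction_on with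
    | empty =>
      obtain ⟨q, hq, _⟩ := h.pos (Classical.arbitrary ι)
      exact ⟨q, hq, by simp⟩
    | insert j S hj ih =>
      obtain ⟨y, hy, hpos⟩ := ih
      obtain ⟨q, hq, hqp⟩ := h.pos j
      refine ⟨(1/2 : ℝ) • (q - y) + y, h.comb_mem hq hy (by norm_num) (by norm_num), ?_⟩
      intro i hi
      rw [aff_comb]
      have h1 := ((h.mem_iff y).1 hy).2 i
      have h2 := ((h.mem_iff q).1 hq).2 i
      rcases Finset.mem_insert.1 hi with rfl | hi
      · linarith
      · have := hpos i hi
        linarith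
  obtain ⟨y, hy, hp⟩ := this Finset.univ
  exact ⟨y, hy, fun i => hp i (Finset.mem_univ i)⟩

lemma IrredSys.exists_facet [Fintype ι] (h : IrredSys Q σ) (i : ι) :
    ∃ y ∈ Q, ∃ w ∈ Q, (∀ j, 0 < σ j y) ∧ σ i w = 0 ∧ ∀ j, j ≠ i → 0 < σ j w := by
  have : Nonempty ι := ⟨i⟩
  obtain ⟨y, hy, hp⟩ := h.exists_interior
  obtain ⟨v, hv, hvi, hvj⟩ := h.viol i
  have hyi := hp i
  have hden : 0 < σ i y - σ i v := by linarith
  set t := σ i y / (σ i y - σ i v) with ht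
  have ht0 : 0 < t := div_pos hyi hden
  have ht1 : t < 1 := by rw [ht, div_lt_one hden]; linarith
  have hti : t * (σ i y - σ i v) = σ i y := div_mul_cancel₀ _ hden.ne'
  have hwi : σ i (t • (v - y) + y) = 0 := by rw [aff_comb]; linarith
  have hwj : ∀ j, j ≠ i → 0 < σ j (t • (v - y) + y) := by
    intro j hj
    rw [aff_comb]
    have := hvj j hj
    have := hp j
    nlinarith
  refine ⟨y, hy, t • (v - y) + y, ?_, hp, hwi, hwj⟩
  rw [h.mem_iff]
  have hya := ((h.mem_iff y).1 hy).1
  refine ⟨aff_comb_mem _ t hv hya hya, fun j => ?_⟩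
  by_cases hj : j = i
  · rw [hj, hwi]
  · exact (hwj j hj).le

/-- There is a small step which keeps finitely many positive numbers positive. -/
lemma exists_small_step {κ : Type} (S : Finset κ) (a b : κ → ℝ) (ha : ∀ i ∈ S, 0 < a i) :
    ∃ ε : ℝ, 0 < ε ∧ ∀ i ∈ S, 0 ≤ a i + ε * b i := by
  classical
  induction S using Finset.induction_on with
  | empty => exact ⟨1, one_pos, by simp⟩
  | insert j S hj ih =>
    obtain ⟨ε, hε, hS⟩ := ih (fun i hi => ha i (Finset.mem_insert_of_mem hi))
    have haj := ha j (Finset.mem_insert_self j S)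
    have hq : 0 < a j / (1 + |b j|) := by positivity
    refine ⟨min ε (a j / (1 + |b j|)), lt_min hε hq, ?_⟩
    have hm0 : 0 < min ε (a j / (1 + |b j|)) := lt_min hε hq
    intro i hi
    rcases Finset.mem_insert.1 hi with rfl | hi
    · have h1 : min ε (a i / (1 + |b i|)) * (1 + |b i|) ≤ a i := by
        have := min_le_right ε (a i / (1 + |b i|))
        calc _ ≤ a i / (1 + |b i|) * (1 + |b i|) := by gcongr
          _ = a i := div_mul_cancel₀ _ (by positivity)
      have := neg_abs_le (b i)
      nlinarith
    · have h1 := hS i hi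
      have h2 := min_le_left ε (a j / (1 + |b j|))
      have h3 := ha i (Finset.mem_insert_of_mem hi)
      by_cases hb : 0 ≤ b i
      · positivity
      · push Not at hb
        nlinarith

lemma IrredSys.perm_aux [Fintype ι] (h : IrredSys Q σ) (κ : (Fin d → ℝ) →ᵃ[ℝ] (Fin d → ℝ))
    (hκ : κ '' Q = Q) (hinj : Function.Injective κ) (i : ι) :
    ∃ j, ∃ lam : ℝ, 0 < lam ∧ ∀ y ∈ affineSpan ℝ Q, σ j (κ y) = lam * σ i y := by
  classical
  obtain ⟨y0, hy0, w, hw, hp, hwi, hwj⟩ := h.exists_facet i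
  have haff : ∀ y ∈ affineSpan ℝ Q, κ y ∈ affineSpan ℝ Q := by
    intro y hy
    have : κ y ∈ (affineSpan ℝ Q).map κ := AffineSubspace.mem_map_of_mem κ hy
    rwa [AffineSubspace.map_span, hκ] at this
  have hmemκ : ∀ y, κ y ∈ Q → y ∈ Q := by
    intro y hy
    rw [← hκ] at hy
    obtain ⟨z, hz, hzy⟩ := hy
    exact hinj hzy ▸ hz
  have hκmem : ∀ y ∈ Q, κ y ∈ Q := fun y hy => hκ ▸ Set.mem_image_of_mem κ hy
  have hsub : ∀ y ∈ Q, y ∈ affineSpan ℝ Q := fun y hy => ((h.mem_iff y).1 hy).1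
  have hcomp : ∀ j c a b x, σ j (κ (c • (a - b) + x)) = c * (σ j (κ a) - σ j (κ b)) + σ j (κ x) :=
    fun j c a b x => aff_comb ((σ j).comp κ) c a b x
  obtain ⟨j, hj⟩ : ∃ j, σ j (κ w) = 0 := by
    by_contra hcon
    push Not at hcon
    have hpos : ∀ j, 0 < σ j (κ w) := fun j =>
      lt_of_le_of_ne (((h.mem_iff _).1 (hκmem w hw)).2 j) (hcon j).symm
    obtain ⟨ε, hε, hS⟩ := exists_small_step Finset.univ (fun j => σ j (κ w))
      (fun j => σ j (κ w) - σ j (κ y0)) (fun j _ => hpos j)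
    have hin : ε • (w - y0) + w ∈ Q := by
      apply hmemκ
      rw [h.mem_iff]
      refine ⟨haff _ (aff_comb_mem _ ε (hsub w hw) (hsub y0 hy0) (hsub w hw)), fun j => ?_⟩
      rw [hcomp]
      have := hS j (Finset.mem_univ j)
      linarith
    have := ((h.mem_iff _).1 hin).2 i
    rw [aff_comb, hwi] at this
    have := hp i
    nlinarith
  have hnn : ∀ y ∈ affineSpan ℝ Q, 0 ≤ σ i y → 0 ≤ σ j (κ y) := by
    intro y hy hiy
    obtain ⟨ε, hε, hS⟩ := exists_small_step (Finset.univ.erase i) (fun k => σ k w)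
      (fun k => σ k y - σ k w) (fun k hk => hwj k (Finset.ne_of_mem_erase hk))
    have hin : ε • (y - w) + w ∈ Q := by
      rw [h.mem_iff]
      refine ⟨aff_comb_mem _ ε hy (hsub w hw) (hsub w hw), fun k => ?_⟩
      rw [aff_comb]
      by_cases hk : k = i
      · rw [hk, hwi]; nlinarith
      · have := hS k (Finset.mem_erase.2 ⟨hk, Finset.mem_univ k⟩)
        linarith
    have := ((h.mem_iff _).1 (hκmem _ hin)).2 j
    rw [hcomp, hj] at this
    by_contra hneg
    push Not at hneg
    nlinarith
  have hlin : ∀ y ∈ affineSpan ℝ Q, σ j (κ y) = σ j (κ y0) / σ i y0 * σ i y := by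
    intro y hy
    have hp0 := hp i
    set c := σ i y / σ i y0 with hc
    have hcm : c * σ i y0 = σ i y := div_mul_cancel₀ _ hp0.ne'
    have m1 : c • (w - y0) + y ∈ affineSpan ℝ Q := aff_comb_mem _ c (hsub w hw) (hsub y0 hy0) hy
    have s1 : σ i (c • (w - y0) + y) = 0 := by rw [aff_comb, hwi]; linarith
    have p1 := hnn _ m1 s1.ge
    have m2 : (1 : ℝ) • (w - (c • (w - y0) + y)) + w ∈ affineSpan ℝ Q :=
      aff_comb_mem _ 1 (hsub w hw) m1 (hsub w hw)
    have s2 : σ i ((1 : ℝ) • (w - (c • (w - y0) + y)) + w) = 0 := by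
      rw [aff_comb, hwi, s1]; simp
    have p2 := hnn _ m2 s2.ge
    rw [hcomp, hj] at p2
    have e : σ j (κ (c • (w - y0) + y)) = 0 := by linarith
    rw [hcomp, hj] at e
    have : σ j (κ y) = c * σ j (κ y0) := by linarith
    rw [this, hc]; ring
  refine ⟨j, σ j (κ y0) / σ i y0, ?_, hlin⟩
  obtain ⟨q, hq, hqp⟩ := h.pos j
  rw [← hκ] at hq
  obtain ⟨q', hq', rfl⟩ := hq
  rw [hlin q' (hsub q' hq')] at hqp
  have := ((h.mem_iff _).1 hq').2 i
  by_contra hneg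
  push Not at hneg
  nlinarith

/-- The normalisation constant of an affine function on `Q`. -/
noncomputable def lipOn (Q : Set (Fin d → ℝ)) (g : (Fin d → ℝ) → ℝ) : ℝ :=
  sSup {r | ∃ y ∈ Q, ∃ y' ∈ Q, (y - y') ⬝ᵥ (y - y') ≤ 1 ∧ r = g y - g y'}

lemma lipOn_bdd (Q : Set (Fin d → ℝ)) (g : (Fin d → ℝ) →ᵃ[ℝ] ℝ) :
    BddAbove {r | ∃ y ∈ Q, ∃ y' ∈ Q, (y - y') ⬝ᵥ (y - y') ≤ 1 ∧ r = g y - g y'} := by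
  refine ⟨∑ k, |g.linear (fun j => if k = j then 1 else 0)|, ?_⟩
  rintro r ⟨y, _, y', _, hd, rfl⟩
  have h2 := g.linearMap_vsub y y'
  simp only [vsub_eq_sub] at h2
  rw [← h2, LinearMap.pi_apply_eq_sum_univ g.linear (y - y')]
  apply Finset.sum_le_sum
  intro k _
  have hk : |(y - y') k| ≤ 1 := by
    rw [← sq_le_one_iff_abs_le_one]
    refine le_trans ?_ hd
    rw [dotProduct, pow_two]
    exact Finset.single_le_sum (f := fun k => (y - y') k * (y - y') k)
      (fun i _ => mul_self_nonneg _) (Finset.mem_univ k)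
  rw [smul_eq_mul]
  refine (le_abs_self _).trans ?_
  rw [abs_mul]
  exact mul_le_of_le_one_left (abs_nonneg _) hk

lemma IrredSys.lipOn_pos [Fintype ι] (h : IrredSys Q σ) (i : ι) : 0 < lipOn Q (σ i) := by
  obtain ⟨y0, hy0, w, hw, hp, hwi, hwj⟩ := h.exists_facet i
  set D := (y0 - w) ⬝ᵥ (y0 - w) with hD
  have hD0 : 0 ≤ D := Finset.sum_nonneg (fun k _ => mul_self_nonneg _)
  have ht : 0 < 1 / (1 + D) := by positivity
  have ht1 : 1 / (1 + D) ≤ 1 := by rw [div_le_one (by positivity)]; linarith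
  have hmem := h.comb_mem hy0 hw ht.le ht1
  have hb := lipOn_bdd Q (σ i)
  have : (1 / (1 + D)) * σ i y0 ≤ lipOn Q (σ i) := by
    apply le_csSup hb
    refine ⟨_, hmem, w, hw, ?_, ?_⟩
    · rw [add_sub_cancel_right, smul_dotProduct, dotProduct_smul, smul_eq_mul, smul_eq_mul, ← hD]
      have h1 : 1 / (1 + D) * D ≤ 1 := by
        rw [one_div_mul_eq_div, div_le_one (by positivity)]; linarith
      nlinarith
    · rw [aff_comb, hwi]; ring
  have := hp i
  have : 0 < (1 / (1 + D)) * σ i y0 := by positivity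
  linarith

lemma IrredSys.lip_scale (κ : (Fin d → ℝ) →ᵃ[ℝ] (Fin d → ℝ))
    (hκ : κ '' Q = Q) (hiso : ∀ y y', (κ y - κ y') ⬝ᵥ (κ y - κ y') = (y - y') ⬝ᵥ (y - y'))
    (g g' : (Fin d → ℝ) → ℝ) (lam : ℝ) (hl : 0 < lam) (hg : ∀ y ∈ Q, g (κ y) = lam * g' y) :
    lipOn Q g = lam * lipOn Q g' := by
  unfold lipOn
  rw [← smul_eq_mul, ← Real.sSup_smul_of_nonneg hl.le]
  congr 1
  ext r
  rw [Set.mem_smul_set]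
  constructor
  · rintro ⟨y, hy, y', hy', hd, rfl⟩
    rw [← hκ] at hy hy'
    obtain ⟨z, hz, rfl⟩ := hy
    obtain ⟨z', hz', rfl⟩ := hy'
    rw [hiso] at hd
    refine ⟨g' z - g' z', ⟨z, hz, z', hz', hd, rfl⟩, ?_⟩
    rw [hg z hz, hg z' hz', smul_eq_mul]; ring
  · rintro ⟨s, ⟨y, hy, y', hy', hd, rfl⟩, rfl⟩
    refine ⟨κ y, hκ ▸ Set.mem_image_of_mem κ hy, κ y', hκ ▸ Set.mem_image_of_mem κ hy', ?_, ?_⟩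
    · rw [hiso]; exact hd
    · rw [hg y hy, hg y' hy', smul_eq_mul]; ring

/-- The normalised slack functions. -/
noncomputable def nslack (Q : Set (Fin d → ℝ)) (σ : ι → (Fin d → ℝ) →ᵃ[ℝ] ℝ) (i : ι) : (Fin d → ℝ) →ᵃ[ℝ] ℝ :=
  (lipOn Q (σ i))⁻¹ • σ i

lemma IrredSys.exists_perm [Fintype ι] (h : IrredSys Q σ) (κ : (Fin d → ℝ) →ᵃ[ℝ] (Fin d → ℝ))
    (hκ : κ '' Q = Q) (hinj : Function.Injective κ)
    (hiso : ∀ y y', (κ y - κ y') ⬝ᵥ (κ y - κ y') = (y - y') ⬝ᵥ (y - y')) :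
    ∃ θ : Equiv.Perm ι, ∀ i, ∀ y ∈ Q, nslack Q σ (θ i) (κ y) = nslack Q σ i y := by
  choose j lam hlam hj using h.perm_aux κ hκ hinj
  have hji : Function.Injective j := by
    intro a b hab
    by_contra hne
    obtain ⟨v, hv, h1, h2⟩ := h.viol a
    have e1 := hj a v hv
    have e2 := hj b v hv
    rw [hab, e2] at e1
    have := h2 b (Ne.symm hne)
    have := hlam a
    have := hlam b
    nlinarith [mul_nonneg (hlam b).le (h2 b (Ne.symm hne)), mul_neg_of_pos_of_neg (hlam a) h1]
  refine ⟨Equiv.ofBijective j ((Finite.injective_iff_bijective).1 hji), ?_⟩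
  intro i y hy
  have hya := ((h.mem_iff y).1 hy).1
  have hs := IrredSys.lip_scale κ hκ hiso (σ (j i)) (σ i) (lam i) (hlam i)
    (fun y hy => hj i y ((h.mem_iff y).1 hy).1)
  show (lipOn Q (σ (j i)))⁻¹ • (σ (j i) (κ y)) = (lipOn Q (σ i))⁻¹ • (σ i y)
  rw [hs, hj i y hya]
  have h1 := (h.lipOn_pos i).ne'
  have h2 := (hlam i).ne'
  simp only [smul_eq_mul]
  field_simp

lemma IrredSys.nslack_mem_iff [Fintype ι] (h : IrredSys Q σ) (y : Fin d → ℝ) :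
    y ∈ Q ↔ y ∈ affineSpan ℝ Q ∧ ∀ i, 0 ≤ nslack Q σ i y := by
  rw [h.mem_iff]
  have : ∀ i, 0 ≤ nslack Q σ i y ↔ 0 ≤ σ i y := by
    intro i
    show 0 ≤ (lipOn Q (σ i))⁻¹ * (σ i y) ↔ _
    have := inv_pos.2 (h.lipOn_pos i)
    exact mul_nonneg_iff_of_pos_left this
  simp [this]

end irred

/-! ### Averaging: symmetric slack functions -/

lemma aff_sum {E F Ω : Type*} [AddCommGroup E] [Module ℝ E] [AddCommGroup F] [Module ℝ F]
    (φ : E →ᵃ[ℝ] F) (S : Finset Ω) (w : Ω → ℝ) (y : Ω → E) (hw : ∑ i ∈ S, w i = 1) :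
    φ (∑ i ∈ S, w i • y i) = ∑ i ∈ S, w i • φ (y i) := by
  have hd : ∀ z, φ z = φ.linear z + φ 0 := fun z => by
    have := φ.map_vadd 0 z
    simpa using this
  rw [hd, map_sum]
  simp_rw [map_smul]
  have : ∀ i ∈ S, w i • φ (y i) = w i • φ.linear (y i) + w i • φ 0 := fun i _ => by
    rw [hd (y i), smul_add]
  rw [Finset.sum_congr rfl this, Finset.sum_add_distrib, ← Finset.sum_smul, hw, one_smul]

lemma sum_mem_affineSpan {E Ω : Type*} [AddCommGroup E] [Module ℝ E] (Q : Set E)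
    (S : Finset Ω) (w : Ω → ℝ) (y : Ω → E) (hw : ∑ i ∈ S, w i = 1) (hy : ∀ i, y i ∈ Q) :
    ∑ i ∈ S, w i • y i ∈ affineSpan ℝ Q := by
  rw [← Finset.affineCombination_eq_linear_combination S y w hw]
  refine affineSpan_mono ℝ (Set.range_subset_iff.2 hy) ?_
  exact affineCombination_mem_affineSpan hw y

lemma edgeAction_one {n : ℕ} (x : Edge n → ℝ) : edgeAction 1 x = x := by
  funext e
  simp only [edgeAction, edgeMap, inv_one]
  congr 1
  apply Subtype.ext
  simp

lemma edgeAction_mul {n : ℕ} (π τ : Equiv.Perm (Fin n)) (x : Edge n → ℝ) :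
    edgeAction (π * τ) x = edgeAction π (edgeAction τ x) := by
  funext e
  simp only [edgeAction, edgeMap, mul_inv_rev]
  congr 1
  apply Subtype.ext
  simp only [Sym2.map_map]
  congr 1

lemma cycleVec_smul {n ℓ : ℕ} (π : Equiv.Perm (Fin n)) (x : Fin ℓ ↪ Fin n) :
    cycleVec (π • x : Fin ℓ ↪ Fin n) = edgeAction π (cycleVec x) := by
  funext e
  simp only [edgeAction, cycleVec, edgeMap]
  congr 1
  simp only [Finset.mem_image, Finset.mem_univ, true_and, eq_iff_iff]
  refine exists_congr fun i => ?_
  obtain ⟨e, he⟩ := e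
  induction e with
  | _ a b =>
    simp only [Sym2.map_mk, Function.Embedding.smul_apply, Equiv.Perm.smul_def, Sym2.eq_iff,
      Equiv.Perm.eq_inv_iff_eq]

theorem propA {n ℓ d g f : ℕ} (Aeq : Fin g → Fin d → ℝ) (beq : Fin g → ℝ)
    (A : Fin f → Fin d → ℝ) (b : Fin f → ℝ) (Q : Set (Fin d → ℝ))
    (hQ : Q = {y : Fin d → ℝ |
              (∀ i : Fin g, ∑ j, Aeq i j * y j = beq i) ∧
              (∀ i : Fin f, ∑ j, A i j * y j ≤ b i)})
    (p : (Fin d → ℝ) →ᵃ[ℝ] (Edge n → ℝ)) (hp : p '' Q = cyclePolytope n ℓ)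
    (hsym : ∀ π : Equiv.Perm (Fin n),
              ∃ (U : Matrix (Fin d) (Fin d) ℝ) (u : Fin d → ℝ),
                U * U.transpose = 1 ∧
                (fun y : Fin d → ℝ => U.mulVec y + u) '' Q = Q ∧
                ∀ y ∈ Q, p (U.mulVec y + u) = edgeAction π (p y)) :
    ∃ (I : Finset (Fin f)) (s : {i // i ∈ I} → (Fin ℓ ↪ Fin n) → ℝ),
      (∀ i x, 0 ≤ s i x) ∧
      (∀ π : Equiv.Perm (Fin n), ∃ θ : Equiv.Perm {i // i ∈ I}, ∀ i x, s (θ i) (π • x) = s i x) ∧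
      (∀ (Ω : Type) [Fintype Ω] (a : Ω → ℝ) (x : Ω → (Fin ℓ ↪ Fin n)), ∑ ω, a ω = 1 →
        (∀ i, 0 ≤ ∑ ω, a ω * s i (x ω)) →
        ∑ ω, a ω • cycleVec (x ω) ∈ cyclePolytope n ℓ) := by
  classical
  -- the inequalities as affine maps
  let σ : Fin f → (Fin d → ℝ) →ᵃ[ℝ] ℝ := fun i =>
    AffineMap.const ℝ _ (b i) - (∑ j, A i j • (LinearMap.proj j : (Fin d → ℝ) →ₗ[ℝ] ℝ)).toAffineMap
  have hσ : ∀ i y, σ i y = b i - ∑ j, A i j * y j := by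
    intro i y
    simp [σ]
  have hQ' : ∀ y, y ∈ Q ↔ y ∈ affineSpan ℝ Q ∧ ∀ i, 0 ≤ σ i y := by
    intro y
    constructor
    · intro h
      refine ⟨mem_affineSpan ℝ h, fun i => ?_⟩
      rw [hQ] at h
      have := h.2 i
      rw [hσ]; linarith
    · rintro ⟨h1, h2⟩
      rw [hQ]
      refine ⟨fun i => ?_, fun i => ?_⟩
      · let τ : (Fin d → ℝ) →ₗ[ℝ] ℝ := ∑ j, Aeq i j • (LinearMap.proj j : (Fin d → ℝ) →ₗ[ℝ] ℝ)
        have hτ : ∀ y, τ y = ∑ j, Aeq i j * y j := by intro y; simp [τ]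
        have hle : affineSpan ℝ Q ≤ (affineSpan ℝ ({beq i} : Set ℝ)).comap τ.toAffineMap := by
          rw [affineSpan_le]
          intro z hz
          show τ z ∈ affineSpan ℝ ({beq i} : Set ℝ)
          rw [hQ] at hz
          rw [hτ, hz.1 i]
          exact mem_affineSpan ℝ rfl
        have h0 : τ y ∈ affineSpan ℝ ({beq i} : Set ℝ) := hle h1
        rw [AffineSubspace.mem_affineSpan_singleton, hτ] at h0
        exact h0
      · have := h2 i
        rw [hσ] at this; linarith
  obtain ⟨I, hI⟩ := exists_irred Q σ hQ'
  set N : {i // i ∈ I} → (Fin d → ℝ) →ᵃ[ℝ] ℝ := nslack Q (fun i : {i // i ∈ I} => σ i) with hN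
  have hmem : ∀ y, y ∈ Q ↔ y ∈ affineSpan ℝ Q ∧ ∀ i, 0 ≤ N i y := hI.nslack_mem_iff
  have hconv : Convex ℝ Q := by
    rw [convex_iff_forall_pos]
    intro x hx y hy s t hs ht hst
    rw [hmem] at hx hy ⊢
    have e : s • x + t • y = s • (x - y) + y := by
      have : t = 1 - s := by linarith
      rw [this]; module
    rw [e]
    refine ⟨aff_comb_mem _ s hx.1 hy.1 hy.1, fun i => ?_⟩
    rw [aff_comb]
    have := hx.2 i
    have := hy.2 i
    nlinarith
  -- the pairs
  let P : Equiv.Perm {i // i ∈ I} × Equiv.Perm (Fin n) → Prop := fun h =>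
    ∀ y ∈ Q, ∃ y' ∈ Q, (∀ i, N (h.1 i) y' = N i y) ∧ p y' = edgeAction h.2 (p y)
  have hPmul : ∀ h h', P h → P h' → P (h * h') := by
    intro h h' hh hh' y hy
    obtain ⟨y1, hy1, h1, h2⟩ := hh' y hy
    obtain ⟨y2, hy2, h3, h4⟩ := hh y1 hy1
    refine ⟨y2, hy2, fun i => ?_, ?_⟩
    · rw [← h1 i, ← h3]; rfl
    · rw [h4, h2, ← edgeAction_mul]; rfl
  have hPex : ∀ π, ∃ θ, P (θ, π) := by
    intro π
    obtain ⟨U, u, hU, himg, hpe⟩ := hsym π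
    have hU' : U.transpose * U = 1 := mul_eq_one_comm.1 hU
    let κ : (Fin d → ℝ) →ᵃ[ℝ] (Fin d → ℝ) := (Matrix.mulVecLin U).toAffineMap + AffineMap.const ℝ _ u
    have hκ : ∀ y, κ y = U.mulVec y + u := fun y => by simp [κ]
    have hκ' : ∀ y y', κ y - κ y' = U.mulVec (y - y') := fun y y' => by
      rw [hκ, hκ, Matrix.mulVec_sub]; abel
    have hinj : Function.Injective κ := by
      intro y y' h
      have h1 : U.mulVec (y - y') = 0 := by rw [← hκ', h, sub_self]
      have h2 : (U.transpose * U).mulVec (y - y') = 0 := by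
        rw [← Matrix.mulVec_mulVec, h1, Matrix.mulVec_zero]
      rw [hU', Matrix.one_mulVec] at h2
      exact sub_eq_zero.1 h2
    obtain ⟨θ, hθ⟩ := hI.exists_perm κ (by
      have : (κ : (Fin d → ℝ) → (Fin d → ℝ)) = fun y => U.mulVec y + u := funext hκ
      rw [this]; exact himg) hinj (by
      intro y y'
      rw [hκ', Matrix.dotProduct_mulVec, Matrix.vecMul_mulVec, hU', Matrix.vecMul_one])
    refine ⟨θ, fun y hy => ⟨κ y, ?_, fun i => hθ i y hy, ?_⟩⟩
    · rw [← himg]; exact ⟨y, hy, (hκ y).symm⟩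
    · rw [hκ]; exact hpe y hy
  choose! T hTQ hTN hTp using (fun h (hh : P h) y (hy : y ∈ Q) => hh y hy)
  let H : Finset (Equiv.Perm {i // i ∈ I} × Equiv.Perm (Fin n)) := Finset.univ.filter P
  have hHP : ∀ h, h ∈ H ↔ P h := fun h => by simp [H]
  have hHne : H.Nonempty := by
    obtain ⟨θ, hθ⟩ := hPex 1
    exact ⟨_, (hHP _).2 hθ⟩
  have hy : ∀ x : Fin ℓ ↪ Fin n, ∃ y ∈ Q, p y = cycleVec x := by
    intro x
    have : cycleVec x ∈ cyclePolytope n ℓ := subset_convexHull ℝ _ ⟨x, x.injective, rfl⟩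
    rw [← hp] at this
    exact this
  choose y0 hy0 hpy0 using hy
  have hc : (0:ℝ) < H.card := by exact_mod_cast hHne.card_pos
  have hw : ∑ _h ∈ H, ((H.card : ℝ)⁻¹) = 1 := by
    rw [Finset.sum_const, nsmul_eq_mul, mul_inv_cancel₀ hc.ne']
  let Y : (Fin ℓ ↪ Fin n) → (Fin d → ℝ) := fun x =>
    ∑ h ∈ H, ((H.card : ℝ)⁻¹) • T h (y0 (h.2⁻¹ • x))
  have hYQ : ∀ x, Y x ∈ Q := fun x =>
    hconv.sum_mem (fun _ _ => inv_nonneg.2 hc.le) hw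
      (fun h hh => hTQ h ((hHP h).1 hh) _ (hy0 _))
  have hYp : ∀ x, p (Y x) = cycleVec x := by
    intro x
    rw [aff_sum p H _ _ hw]
    rw [Finset.sum_congr rfl (g := fun h => (H.card : ℝ)⁻¹ • cycleVec x)]
    · rw [← Finset.sum_smul, hw, one_smul]
    · intro h hh
      rw [hTp h ((hHP h).1 hh) _ (hy0 _), hpy0, ← cycleVec_smul, smul_inv_smul]
  have hYN : ∀ i x, N i (Y x) = ∑ h ∈ H, (H.card : ℝ)⁻¹ * N (h.1⁻¹ i) (y0 (h.2⁻¹ • x)) := by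
    intro i x
    rw [aff_sum (N i) H _ _ hw]
    refine Finset.sum_congr rfl fun h hh => ?_
    have := hTN h ((hHP h).1 hh) _ (hy0 (h.2⁻¹ • x)) (h.1⁻¹ i)
    rw [perm_apply_inv] at this
    rw [this, smul_eq_mul]
  refine ⟨I, fun i x => N i (Y x), fun i x => ((hmem _).1 (hYQ x)).2 i, ?_, ?_⟩
  · intro π
    obtain ⟨θ, hθ⟩ := hPex π
    refine ⟨θ, fun i x => ?_⟩
    have himg : H.image (fun h => (θ, π) * h) = H := by
      apply Finset.eq_of_subset_of_card_le
      · intro h hh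
        obtain ⟨h', hh', rfl⟩ := Finset.mem_image.1 hh
        exact (hHP _).2 (hPmul _ _ hθ ((hHP _).1 hh'))
      · rw [Finset.card_image_of_injective _ (mul_right_injective _)]
    show N (θ i) (Y (π • x)) = N i (Y x)
    rw [hYN, hYN, ← himg, Finset.sum_image (fun a _ b _ h => mul_right_injective _ h), himg]
    refine Finset.sum_congr rfl fun h hh => ?_
    have e1 : ((θ, π) * h).1⁻¹ (θ i) = h.1⁻¹ i := by
      simp only [Prod.fst_mul, mul_inv_rev, Equiv.Perm.mul_apply]
      rw [perm_inv_apply]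
    have e2 : ((θ, π) * h).2⁻¹ • π • x = h.2⁻¹ • x := by
      simp only [Prod.snd_mul, mul_inv_rev, mul_smul, inv_smul_smul]
    rw [e1, e2]
  · intro Ω _ a x ha hs
    rw [← hp]
    refine ⟨∑ ω, a ω • Y (x ω), ?_, ?_⟩
    · rw [hmem]
      refine ⟨sum_mem_affineSpan Q _ _ _ ha (fun ω => hYQ _), fun i => ?_⟩
      rw [aff_sum (N i) _ _ _ ha]
      exact hs i
    · rw [aff_sum p _ _ _ ha]
      simp_rw [hYp]

/-- Stabilizers of the slack functions have small index. -/
lemma index_stab {n ℓ : ℕ} {ι : Type} [Fintype ι] (s : ι → (Fin ℓ ↪ Fin n) → ℝ)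
    (h : ∀ π : Equiv.Perm (Fin n), ∃ θ : Equiv.Perm ι, ∀ i x, s (θ i) (π • x) = s i x) (i : ι) :
    ∃ G : Subgroup (Equiv.Perm (Fin n)), G.index ≤ Fintype.card ι ∧
      ∀ π ∈ G, ∀ x, s i (π • x) = s i x := by
  classical
  let G : Subgroup (Equiv.Perm (Fin n)) :=
    { carrier := {π | ∀ x, s i (π • x) = s i x}
      one_mem' := fun x => by rw [one_smul]
      mul_mem' := fun {a b} ha hb x => by rw [mul_smul, ha, hb]
      inv_mem' := fun {a} ha x => by
        have := ha (a⁻¹ • x)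
        rw [smul_inv_smul] at this
        exact this.symm }
  refine ⟨G, ?_, fun π hπ => hπ⟩
  choose θ hθ using h
  rw [Subgroup.index, ← Nat.card_eq_fintype_card]
  refine Nat.card_le_card_of_injective (fun q => θ q.out i) ?_
  intro q q' hqq
  rw [← QuotientGroup.out_eq' q, ← QuotientGroup.out_eq' q']
  rw [QuotientGroup.eq]
  intro x
  have h1 := hθ q.out i (q.out⁻¹ • q'.out • x)
  have h2 := hθ q'.out i x
  rw [smul_inv_smul] at h1
  simp only at hqq
  rw [mul_smul, ← h1, hqq, h2]

/-! ### Part C: counting -/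

lemma exists_perm_ext {α : Type} [Fintype α] [DecidableEq α] (S : Finset α) (v : α → α)
    (hv : Set.InjOn v S) : ∃ ρ : Equiv.Perm α, ∀ p ∈ S, ρ p = v p := by
  obtain ⟨g, hg⟩ := Finset.exists_equiv_extend_of_card_eq (t := (Finset.univ : Finset α))
    (Finset.card_univ (α := α)).symm (s := S) (f := v) (Finset.subset_univ _) hv
  refine ⟨g.trans (Equiv.subtypeUnivEquiv (fun x => Finset.mem_univ x)), fun p hp => ?_⟩
  exact hg p hp

/-- number of permutations fixing `S` pointwise -/
def fixCount {α : Type} [Fintype α] [DecidableEq α] (S : Finset α) : ℕ :=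
  ((Finset.univ : Finset (Equiv.Perm α)).filter (fun ρ => ∀ p ∈ S, ρ p = p)).card

lemma ext_count {α : Type} [Fintype α] [DecidableEq α] (S : Finset α) (v : α → α)
    (hv : Set.InjOn v S) :
    ((Finset.univ : Finset (Equiv.Perm α)).filter (fun ρ => ∀ p ∈ S, ρ p = v p)).card
      = fixCount S := by
  obtain ⟨ρ0, h0⟩ := exists_perm_ext S v hv
  symm
  refine Finset.card_bij (fun ρ _ => ρ0 * ρ) ?_ ?_ ?_
  · intro ρ hρ
    simp only [Finset.mem_filter, Finset.mem_univ, true_and] at hρ ⊢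
    intro p hp
    rw [Equiv.Perm.mul_apply, hρ p hp, h0 p hp]
  · intro a _ b _ h
    exact mul_left_cancel h
  · intro ρ hρ
    simp only [Finset.mem_filter, Finset.mem_univ, true_and] at hρ
    refine ⟨ρ0⁻¹ * ρ, ?_, by group⟩
    simp only [Finset.mem_filter, Finset.mem_univ, true_and]
    intro p hp
    rw [Equiv.Perm.mul_apply, hρ p hp, ← h0 p hp, perm_inv_apply]

/-- number of side-preserving permutations fixing `W` pointwise -/
def fixCount2 {α : Type} [Fintype α] [DecidableEq α] (W : Finset (α × Bool)) : ℕ :=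
  ((Finset.univ : Finset (Bool → Equiv.Perm α)).filter (fun σ => ∀ w ∈ W, σ w.2 w.1 = w.1)).card

lemma ext_count2 {α : Type} [Fintype α] [DecidableEq α] (W : Finset (α × Bool)) (v : α × Bool → α)
    (hv : ∀ w ∈ W, ∀ w' ∈ W, v w = v w' → w.2 = w'.2 → w = w') :
    ((Finset.univ : Finset (Bool → Equiv.Perm α)).filter (fun σ => ∀ w ∈ W, σ w.2 w.1 = v w)).card
      = fixCount2 W := by
  have hex : ∀ s : Bool, ∃ ρ : Equiv.Perm α, ∀ p ∈ (W.filter (fun w => w.2 = s)).image Prod.fst,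
      ρ p = v (p, s) := by
    intro s
    apply exists_perm_ext
    intro p hp q hq hpq
    simp only [Finset.coe_image, Finset.coe_filter, Set.mem_image, Set.mem_ofPred_eq] at hp hq
    obtain ⟨⟨p', s'⟩, ⟨h1, h2⟩, h3⟩ := hp
    obtain ⟨⟨q', s''⟩, ⟨h1', h2'⟩, h3'⟩ := hq
    simp only at h2 h3 h2' h3'
    subst h2 h3 h2' h3'
    have := hv _ h1 _ h1' hpq rfl
    simpa using this
  choose σ0 h0' using hex
  have h0 : ∀ w ∈ W, σ0 w.2 w.1 = v w := fun w hw => by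
    apply h0' w.2 w.1
    simp only [Finset.mem_image, Finset.mem_filter]
    exact ⟨w, ⟨hw, rfl⟩, rfl⟩
  symm
  refine Finset.card_bij (fun ρ _ => σ0 * ρ) ?_ ?_ ?_
  · intro ρ hρ
    simp only [Finset.mem_filter, Finset.mem_univ, true_and] at hρ ⊢
    intro p hp
    rw [Pi.mul_apply, Equiv.Perm.mul_apply, hρ p hp, h0 p hp]
  · intro a _ b _ h
    exact mul_left_cancel h
  · intro ρ hρ
    simp only [Finset.mem_filter, Finset.mem_univ, true_and] at hρ
    refine ⟨σ0⁻¹ * ρ, ?_, by group⟩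
    simp only [Finset.mem_filter, Finset.mem_univ, true_and]
    intro p hp
    rw [Pi.mul_apply, Equiv.Perm.mul_apply, hρ p hp, ← h0 p hp, Pi.inv_apply, perm_inv_apply]

/-- Ordered choices of distinct items with prescribed sets of types. -/
def cnt {Ty R : Type} [DecidableEq Ty] [CommRing R] : List (Finset Ty) → (Ty → R) → R
  | [], _ => 1
  | A :: L, n => ∑ t ∈ A, n t * cnt L (n - Pi.single t 1)

lemma cnt_map {Ty R R' : Type} [DecidableEq Ty] [CommRing R] [CommRing R'] (φ : R →+* R')
    (L : List (Finset Ty)) : ∀ n : Ty → R, φ (cnt L n) = cnt L (fun t => φ (n t)) := by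
  induction L with
  | nil => intro n; simp [cnt]
  | cons A L ih =>
    intro n
    simp only [cnt, map_sum, map_mul, ih]
    refine Finset.sum_congr rfl fun t _ => ?_
    congr 2
    funext t'
    by_cases h : t' = t
    · subst h; simp
    · simp [h]

lemma cnt_natDegree {Ty : Type} [DecidableEq Ty] (L : List (Finset Ty)) :
    ∀ n : Ty → Polynomial ℝ, (∀ t, (n t).natDegree ≤ 1) → (cnt L n).natDegree ≤ L.length := by
  induction L with
  | nil => intro n _; simp [cnt]
  | cons A L ih =>
    intro n hn
    simp only [cnt, List.length_cons]
    apply Polynomial.natDegree_sum_le_of_forall_le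
    intro t _
    have h1 := ih (n - Pi.single t 1) (by
      intro t'
      by_cases h : t' = t
      · subst h
        simp only [Pi.sub_apply, Pi.single_eq_same]
        refine (Polynomial.natDegree_sub_le _ _).trans ?_
        simp [hn]
      · simp [h, hn])
    refine Polynomial.natDegree_mul_le.trans ?_
    have := hn t
    omega

lemma cnt_nonneg {Ty : Type} [DecidableEq Ty] (L : List (Finset Ty)) :
    ∀ n : Ty → ℝ, (∀ t, n t = 0 ∨ (L.length : ℝ) - 1 ≤ n t) → 0 ≤ cnt L n := by
  induction L with
  | nil => intro n _; simp [cnt]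
  | cons A L ih =>
    intro n hn
    simp only [cnt]
    apply Finset.sum_nonneg
    intro t _
    rcases hn t with h0 | h1
    · rw [h0, zero_mul]
    · simp only [List.length_cons, Nat.cast_add, Nat.cast_one, add_sub_cancel_right] at h1 hn
      have hL : (0:ℝ) ≤ L.length := Nat.cast_nonneg _
      apply mul_nonneg (hL.trans h1)
      apply ih
      intro t'
      by_cases h : t' = t
      · subst h
        right
        simp only [Pi.sub_apply, Pi.single_eq_same]
        linarith
      · simp only [Pi.sub_apply, Pi.single_eq_of_ne h, sub_zero]
        rcases hn t' with h0 | h1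
        · exact Or.inl h0
        · right; linarith

lemma type_count {α Ty : Type} [Fintype α] [DecidableEq α] [DecidableEq Ty]
    (τ : α → Ty) (Adm : α → Finset Ty) (L : List α) : ∀ (D : Finset α) (v : α → α), L.Nodup →
    (∀ p ∈ L, p ∉ D) → Set.InjOn v D →
    (((Finset.univ : Finset (Equiv.Perm α)).filter
      (fun ρ => (∀ p ∈ D, ρ p = v p) ∧ ∀ p ∈ L, τ (ρ p) ∈ Adm p)).card : ℝ)
      = fixCount (D ∪ L.toFinset) * cnt (L.map Adm) (fun t =>
        (((Finset.univ : Finset α).filter (fun a => τ a = t ∧ a ∉ D.image v)).card : ℝ)) := by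
  induction L with
  | nil =>
    intro D v _ _ hv
    simp only [List.not_mem_nil, false_imp_iff, implies_true, and_true, List.toFinset_nil,
      Finset.union_empty, List.map_nil, cnt, mul_one]
    rw [ext_count D v hv]
  | cons p0 L ih =>
    intro D v hnd hD hv
    rw [List.nodup_cons] at hnd
    have hp0 : p0 ∉ D := hD p0 (by simp)
    set B : Finset α := (Finset.univ : Finset α).filter (fun a => τ a ∈ Adm p0 ∧ a ∉ D.image v)
      with hB
    -- split according to the image of `p0`
    have hsplit : ((Finset.univ : Finset (Equiv.Perm α)).filter
      (fun ρ => (∀ p ∈ D, ρ p = v p) ∧ ∀ p ∈ p0 :: L, τ (ρ p) ∈ Adm p)).card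
      = ∑ a ∈ B, ((Finset.univ : Finset (Equiv.Perm α)).filter
        (fun ρ => (∀ p ∈ insert p0 D, ρ p = Function.update v p0 a p) ∧
          ∀ p ∈ L, τ (ρ p) ∈ Adm p)).card := by
      rw [Finset.card_eq_sum_card_fiberwise (f := fun ρ : Equiv.Perm α => ρ p0) (t := B)]
      · refine Finset.sum_congr rfl fun a ha => ?_
        congr 1
        ext ρ
        simp only [Finset.mem_filter, Finset.mem_univ, true_and, List.mem_cons, forall_eq_or_imp,
          Finset.mem_insert, Function.update_self]
        have hupd : (∀ p ∈ D, ρ p = Function.update v p0 a p) ↔ (∀ p ∈ D, ρ p = v p) := by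
          refine forall₂_congr fun p hp => ?_
          rw [Function.update_of_ne (show p ≠ p0 from fun h => hp0 (h ▸ hp))]
        rw [hupd]
        simp only [hB, Finset.mem_filter] at ha
        constructor
        · rintro ⟨⟨h1, h2, h3⟩, h4⟩
          exact ⟨⟨h4, h1⟩, h3⟩
        · rintro ⟨⟨h4, h1⟩, h3⟩
          exact ⟨⟨h1, by rw [h4]; exact ha.2.1, h3⟩, h4⟩
      · intro ρ hρ
        simp only [Finset.coe_filter, Finset.mem_univ, true_and, Set.mem_ofPred_eq, List.mem_cons,
          forall_eq_or_imp] at hρ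
        simp only [hB, Finset.coe_filter, Finset.mem_univ, true_and, Set.mem_ofPred_eq,
          Finset.mem_image, not_exists, not_and]
        refine ⟨hρ.2.1, fun p hp h => ?_⟩
        rw [← hρ.1 p hp] at h
        exact hp0 (ρ.injective h ▸ hp)
    rw [hsplit, Nat.cast_sum]
    have hterm : ∀ a ∈ B, (((Finset.univ : Finset (Equiv.Perm α)).filter
        (fun ρ => (∀ p ∈ insert p0 D, ρ p = Function.update v p0 a p) ∧
          ∀ p ∈ L, τ (ρ p) ∈ Adm p)).card : ℝ) =
        fixCount (D ∪ (p0 :: L).toFinset) * cnt (L.map Adm) ((fun t =>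
        (((Finset.univ : Finset α).filter (fun a => τ a = t ∧ a ∉ D.image v)).card : ℝ))
          - Pi.single (τ a) 1) := by
      intro a ha
      simp only [hB, Finset.mem_filter, Finset.mem_univ, true_and] at ha
      have himg : (insert p0 D).image (Function.update v p0 a) = insert a (D.image v) := by
        rw [Finset.image_insert, Function.update_self]
        congr 1
        refine Finset.image_congr fun p hp => ?_
        rw [Function.update_of_ne (show p ≠ p0 from fun h => hp0 (h ▸ hp))]
      rw [ih (insert p0 D) (Function.update v p0 a) hnd.2]
      · have e : insert p0 D ∪ L.toFinset = D ∪ (p0 :: L).toFinset := by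
          ext x; simp only [Finset.mem_union, Finset.mem_insert, List.toFinset_cons]; tauto
        rw [e, himg]
        congr 2
        funext t
        simp only [Pi.sub_apply]
        by_cases h : t = τ a
        · subst h
          rw [Pi.single_eq_same]
          have : (Finset.univ : Finset α).filter (fun x => τ x = τ a ∧ x ∉ D.image v)
            = insert a ((Finset.univ : Finset α).filter
              (fun x => τ x = τ a ∧ x ∉ insert a (D.image v))) := by
            ext x
            simp only [Finset.mem_filter, Finset.mem_univ, true_and, Finset.mem_insert]
            by_cases hx : x = a
            · subst hx; simp only [ha.2, not_false_eq_true, and_self, true_or]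
            · tauto
          rw [this, Finset.card_insert_of_notMem (by simp)]
          push_cast; ring
        · rw [Pi.single_eq_of_ne h, sub_zero]
          congr 2
          ext x
          simp only [Finset.mem_filter, Finset.mem_univ, true_and, Finset.mem_insert]
          constructor
          · rintro ⟨h1, h2⟩; exact ⟨h1, fun h => h2 (Or.inr h)⟩
          · rintro ⟨h1, h2⟩
            refine ⟨h1, ?_⟩
            rintro (rfl | h3)
            · exact h h1.symm
            · exact h2 h3
      · intro p hp
        rw [Finset.mem_insert]
        rintro (rfl | h)
        · exact hnd.1 hp
        · exact hD p (List.mem_cons_of_mem _ hp) h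
      · rw [Finset.coe_insert, Set.injOn_insert (by simpa using hp0)]
        have heq : Set.EqOn (Function.update v p0 a) v D := fun p hp =>
          Function.update_of_ne (show p ≠ p0 from fun h => hp0 (h ▸ hp)) _ _
        refine ⟨heq.injOn_iff.2 hv, ?_⟩
        rw [heq.image_eq, Function.update_self]
        have := ha.2
        simpa using this
    rw [Finset.sum_congr rfl hterm, ← Finset.mul_sum]
    congr 1
    simp only [List.map_cons, cnt]
    rw [← Finset.sum_fiberwise_of_maps_to (s := B) (t := Adm p0) (g := τ)
      (fun a ha => by simp only [hB, Finset.mem_filter] at ha; exact ha.2.1)]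
    refine Finset.sum_congr rfl fun t ht => ?_
    have : ∀ a ∈ B.filter (fun a => τ a = t), cnt (L.map Adm) ((fun t =>
        (((Finset.univ : Finset α).filter (fun a => τ a = t ∧ a ∉ D.image v)).card : ℝ))
          - Pi.single (τ a) 1) = cnt (L.map Adm) ((fun t =>
        (((Finset.univ : Finset α).filter (fun a => τ a = t ∧ a ∉ D.image v)).card : ℝ))
          - Pi.single t 1) := by
      intro a ha
      rw [(Finset.mem_filter.1 ha).2]
    rw [Finset.sum_congr rfl this, Finset.sum_const, nsmul_eq_mul]
    congr 3
    ext x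
    simp only [hB, Finset.mem_filter, Finset.mem_univ, true_and]
    constructor
    · rintro ⟨⟨h1, h2⟩, h3⟩; exact ⟨h3, h2⟩
    · rintro ⟨h1, h2⟩; exact ⟨⟨h1 ▸ ht, h2⟩, h1⟩

/-! ### The pseudo-distribution -/

lemma lagrange_functional (k : ℕ) : ∃ a : Fin (k + 1) → ℝ, ∀ P : Polynomial ℝ, P.natDegree ≤ k →
    ∑ j, a j * P.eval ((j : ℕ) : ℝ) = P.eval (-1 / 2) := by
  refine ⟨fun j => (Lagrange.basis Finset.univ (fun j : Fin (k + 1) => ((j : ℕ) : ℝ)) j).eval (-1 / 2),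
    fun P hP => ?_⟩
  have hinj : Set.InjOn (fun j : Fin (k + 1) => ((j : ℕ) : ℝ)) (Finset.univ : Finset (Fin (k + 1))) := by
    intro a _ b _ h
    simp only [Nat.cast_inj] at h
    exact Fin.ext h
  have hdeg : P.degree < (Finset.univ : Finset (Fin (k + 1))).card := by
    rw [Finset.card_univ, Fintype.card_fin]
    refine lt_of_le_of_lt Polynomial.degree_le_natDegree ?_
    exact_mod_cast Nat.lt_succ_of_le hP
  conv_rhs => rw [Lagrange.eq_interpolate hinj hdeg, Lagrange.interpolate_apply,
    Polynomial.eval_finsetSum]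
  refine Finset.sum_congr rfl fun j _ => ?_
  rw [Polynomial.eval_mul, Polynomial.eval_C, mul_comm]

/-- the number of pairs of each type, as a polynomial in `j` -/
noncomputable def nP (k : ℕ) (t : Bool → Bool) : Polynomial ℝ :=
  if t = id then 2 * Polynomial.X + 1
  else if t = (fun _ => true) ∨ t = (fun _ => false) then Polynomial.C (k : ℝ) - Polynomial.X else 0

lemma nP_natDegree (k : ℕ) (t : Bool → Bool) : (nP k t).natDegree ≤ 1 := by
  unfold nP
  split_ifs
  · compute_degree
  · compute_degree
  · simp

/-- type of a pair -/
def ptyp {α : Type} (φ : Equiv.Perm (α × Bool)) (p : α) : Bool → Bool := fun e => (φ (p, e)).2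

lemma card_lt_fin (m c : ℕ) (hc : c ≤ m) :
    ((Finset.univ : Finset (Fin m)).filter (fun p : Fin m => (p : ℕ) < c)).card = c := by
  rw [Fin.card_filter_val_lt, min_eq_right hc]

lemma card_ge_lt_fin (m c c' : ℕ) (hc : c ≤ c') (hc' : c' ≤ m) :
    ((Finset.univ : Finset (Fin m)).filter (fun p : Fin m => ¬ ((p : ℕ) < c) ∧ (p : ℕ) < c')).card
      = c' - c := by
  have h := card_lt_fin m c (hc.trans hc')
  have h' := card_lt_fin m c' hc'
  have := Finset.card_filter_add_card_filter_not
    (s := (Finset.univ : Finset (Fin m)).filter (fun p : Fin m => (p : ℕ) < c')) (fun p : Fin m => (p : ℕ) < c)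
  rw [h', Finset.filter_filter, Finset.filter_filter] at this
  have e1 : (Finset.univ : Finset (Fin m)).filter (fun p : Fin m => (p : ℕ) < c' ∧ (p : ℕ) < c)
      = (Finset.univ : Finset (Fin m)).filter (fun p : Fin m => (p : ℕ) < c) := by
    ext p; simp only [Finset.mem_filter, Finset.mem_univ, true_and]; omega
  have e2 : (Finset.univ : Finset (Fin m)).filter (fun p : Fin m => (p : ℕ) < c' ∧ ¬ (p : ℕ) < c)
      = (Finset.univ : Finset (Fin m)).filter (fun p : Fin m => ¬ (p : ℕ) < c ∧ (p : ℕ) < c') := by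
    ext p; simp only [Finset.mem_filter, Finset.mem_univ, true_and]; omega
  rw [e1, e2, h] at this
  omega

lemma exists_base (k j : ℕ) (hj : j ≤ k) : ∃ φ : Equiv.Perm (Fin (2 * k + 1) × Bool), ∀ t,
    (((Finset.univ : Finset (Fin (2 * k + 1))).filter (fun p => ptyp φ p = t)).card : ℝ)
      = (nP k t).eval (j : ℝ) := by
  let T : Fin (2 * k + 1) → Bool → Bool := fun p =>
    if (p : ℕ) < 2 * j + 1 then id else if (p : ℕ) < k + j + 1 then (fun _ => true)
    else (fun _ => false)
  have htrue : (Finset.univ.filter (fun x : Fin (2 * k + 1) × Bool => T x.1 x.2 = true)).card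
      = 2 * k + 1 := by
    have : Finset.univ.filter (fun x : Fin (2 * k + 1) × Bool => T x.1 x.2 = true)
      = ((Finset.univ.filter (fun p : Fin (2 * k + 1) => (p : ℕ) < k + j + 1)) ×ˢ {true}) ∪
        ((Finset.univ.filter (fun p : Fin (2 * k + 1) => ¬ ((p : ℕ) < 2 * j + 1) ∧ (p : ℕ) < k + j + 1)) ×ˢ {false}) := by
      ext ⟨p, e⟩
      simp only [Finset.mem_filter, Finset.mem_univ, true_and, Finset.mem_union, Finset.mem_product,
        Finset.mem_singleton, T]
      by_cases h1 : (p : ℕ) < 2 * j + 1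
      · have : (p : ℕ) < k + j + 1 := by omega
        cases e <;> simp [h1, this]
      · by_cases h2 : (p : ℕ) < k + j + 1
        · cases e <;> simp [h1, h2]
        · cases e <;> simp [h1, h2]
    rw [this, Finset.card_union_of_disjoint, Finset.card_product, Finset.card_product, card_lt_fin,
      card_ge_lt_fin]
    · simp; omega
    · omega
    · omega
    · omega
    · rw [Finset.disjoint_left]
      rintro ⟨p, e⟩ h h'
      simp only [Finset.mem_product, Finset.mem_singleton] at h h'
      rw [h.2] at h'; simp at h'
  have hfalse : (Finset.univ.filter (fun x : Fin (2 * k + 1) × Bool => T x.1 x.2 = false)).card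
      = 2 * k + 1 := by
    have := Finset.card_filter_add_card_filter_not
      (s := (Finset.univ : Finset (Fin (2 * k + 1) × Bool))) (fun x => T x.1 x.2 = true)
    rw [htrue, Finset.card_univ, Fintype.card_prod, Fintype.card_fin, Fintype.card_bool] at this
    simp only [Bool.not_eq_true] at this
    omega
  have hcard : ∀ c : Bool, Nonempty ({x : Fin (2 * k + 1) × Bool // T x.1 x.2 = c} ≃
      {x : Fin (2 * k + 1) × Bool // x.2 = c}) := by
    intro c
    rw [← Fintype.card_eq, Fintype.card_subtype, Fintype.card_subtype]
    have h2 : (Finset.univ.filter (fun x : Fin (2 * k + 1) × Bool => x.2 = c)).card = 2 * k + 1 := by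
      have : Finset.univ.filter (fun x : Fin (2 * k + 1) × Bool => x.2 = c)
        = (Finset.univ : Finset (Fin (2 * k + 1))) ×ˢ {c} := by
        ext ⟨p, e⟩; simp [eq_comm]
      rw [this, Finset.card_product]; simp
    rw [h2]
    cases c
    · exact hfalse
    · exact htrue
  let φ : Equiv.Perm (Fin (2 * k + 1) × Bool) := Equiv.ofFiberEquiv
    (f := fun x : Fin (2 * k + 1) × Bool => T x.1 x.2) (g := fun x => x.2) (fun c => (hcard c).some)
  have hφ : ∀ x, (φ x).2 = T x.1 x.2 := fun x => Equiv.ofFiberEquiv_map _ x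
  have hty : ∀ p, ptyp φ p = T p := fun p => by funext e; exact hφ _
  refine ⟨φ, fun t => ?_⟩
  simp only [hty, nP]
  have hn1 : (fun _ : Bool => true) ≠ id := fun h => by simpa using congrFun h false
  have hn2 : (fun _ : Bool => false) ≠ id := fun h => by simpa using congrFun h true
  have hn3 : (fun _ : Bool => true) ≠ (fun _ : Bool => false) := fun h => by simpa using congrFun h true
  split_ifs with h1 h2
  · subst h1
    have : Finset.univ.filter (fun p => T p = id)
        = Finset.univ.filter (fun p : Fin (2 * k + 1) => (p : ℕ) < 2 * j + 1) := by
      ext p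
      simp only [Finset.mem_filter, Finset.mem_univ, true_and, T]
      split_ifs with h3 h4
      · simp [h3]
      · simp [h3, hn1]
      · simp [h3, hn2]
    rw [this, card_lt_fin _ _ (by omega)]
    simp
  · rcases h2 with rfl | rfl
    · have : Finset.univ.filter (fun p => T p = (fun _ => true))
        = Finset.univ.filter (fun p : Fin (2 * k + 1) => ¬ ((p : ℕ) < 2 * j + 1) ∧ (p : ℕ) < k + j + 1) := by
        ext p
        simp only [Finset.mem_filter, Finset.mem_univ, true_and, T]
        split_ifs with h3 h4
        · simp [h3, hn1.symm]
        · simp [h3, h4]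
        · simp [h4, hn3.symm]
      rw [this, card_ge_lt_fin _ _ _ (by omega) (by omega)]
      have e : k + j + 1 - (2 * j + 1) = k - j := by omega
      rw [e, Nat.cast_sub hj]; simp
    · have : Finset.univ.filter (fun p => T p = (fun _ => false))
        = Finset.univ.filter (fun p : Fin (2 * k + 1) => ¬ ((p : ℕ) < k + j + 1) ∧ (p : ℕ) < 2 * k + 1) := by
        ext p
        have := p.2
        simp only [Finset.mem_filter, Finset.mem_univ, true_and, T]
        split_ifs with h3 h4
        · have : (p : ℕ) < k + j + 1 := by omega
          simp [this, hn2.symm]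
        · simp [h4, hn3]
        · simp only [h4, not_false_eq_true, true_and, this]
      rw [this, card_ge_lt_fin _ _ _ (by omega) (by omega)]
      have e : 2 * k + 1 - (k + j + 1) = k - j := by omega
      rw [e, Nat.cast_sub hj]; simp
  · have : Finset.univ.filter (fun p => T p = t) = ∅ := by
      ext p
      push Not at h2
      simp only [Finset.mem_filter, Finset.mem_univ, true_and, T, Finset.notMem_empty, iff_false]
      split_ifs
      · exact fun h => h1 h.symm
      · exact fun h => h2.1 h.symm
      · exact fun h => h2.2 h.symm
    rw [this]; simp

section psi
variable {α : Type} [Fintype α] [DecidableEq α]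

def sideP (σ : Bool → Equiv.Perm α) : Equiv.Perm (α × Bool) := Equiv.prodCongrLeft σ

def pairP (ρ : Equiv.Perm α) : Equiv.Perm (α × Bool) := Equiv.prodCongrLeft (fun _ => ρ)

/-- node to slot map -/
def psi (φ : Equiv.Perm (α × Bool)) (ρ : Equiv.Perm α) (σ : Bool → Equiv.Perm α) :
    Equiv.Perm (α × Bool) := (pairP ρ)⁻¹ * φ⁻¹ * sideP σ

lemma psi_eq_iff (φ : Equiv.Perm (α × Bool)) (ρ : Equiv.Perm α) (σ : Bool → Equiv.Perm α)
    (w u : α × Bool) : psi φ ρ σ w = u ↔ (σ w.2 w.1, w.2) = φ (ρ u.1, u.2) := by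
  unfold psi
  rw [Equiv.Perm.mul_apply, Equiv.Perm.mul_apply, Equiv.Perm.inv_eq_iff_eq,
    Equiv.Perm.inv_eq_iff_eq]
  rfl

def Adm (W : Finset (α × Bool)) (u : α × Bool → α × Bool) (p : α) : Finset (Bool → Bool) :=
  Finset.univ.filter (fun t => ∀ w ∈ W, (u w).1 = p → t (u w).2 = w.2)

lemma count_u (φ : Equiv.Perm (α × Bool)) (W : Finset (α × Bool)) (u : α × Bool → α × Bool)
    (hu : Set.InjOn u W) :
    ((Finset.univ.filter (fun x : Equiv.Perm α × (Bool → Equiv.Perm α) =>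
      ∀ w ∈ W, psi φ x.1 x.2 w = u w)).card : ℝ)
    = fixCount2 W * fixCount (W.image (fun w => (u w).1)) *
      cnt ((W.image (fun w => (u w).1)).toList.map (Adm W u))
        (fun t => ((Finset.univ.filter (fun p => ptyp φ p = t)).card : ℝ)) := by
  set S := W.image (fun w => (u w).1) with hS
  have htc := type_count (ptyp φ) (Adm W u) S.toList ∅ id S.nodup_toList (by simp) (by simp)
  simp only [Finset.notMem_empty, false_imp_iff, implies_true, true_and, Finset.empty_union,
    Finset.toList_toFinset, Finset.image_empty, not_false_eq_true, and_true, Finset.mem_toList]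
    at htc
  rw [mul_assoc, ← htc, ← Nat.cast_mul, Nat.cast_inj]
  have hadm : ∀ ρ : Equiv.Perm α, (∀ p ∈ S, ptyp φ (ρ p) ∈ Adm W u p) ↔
      ∀ w ∈ W, (φ (ρ (u w).1, (u w).2)).2 = w.2 := by
    intro ρ
    simp only [Adm, Finset.mem_filter, Finset.mem_univ, true_and, hS, Finset.mem_image,
      forall_exists_index, and_imp, ptyp]
    constructor
    · intro h w hw
      exact h _ w hw rfl w hw rfl
    · rintro h p w hw rfl w' hw' he
      rw [← he]; exact h w' hw'
  rw [Finset.card_eq_sum_card_fiberwise (f := Prod.fst)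
    (t := Finset.univ.filter (fun ρ => ∀ p ∈ S, ptyp φ (ρ p) ∈ Adm W u p))]
  · rw [mul_comm, ← smul_eq_mul, ← Finset.sum_const]
    refine Finset.sum_congr rfl fun ρ hρ => ?_
    simp only [Finset.mem_filter, Finset.mem_univ, true_and] at hρ
    rw [hadm] at hρ
    rw [← ext_count2 W (fun w => (φ (ρ (u w).1, (u w).2)).1)]
    · refine Finset.card_bij (fun x _ => x.2) ?_ ?_ ?_
      · rintro ⟨ρ', σ⟩ hx
        simp only [Finset.mem_filter, Finset.mem_univ, true_and] at hx ⊢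
        obtain ⟨h1, rfl⟩ := hx
        intro w hw
        have := (psi_eq_iff _ _ _ _ _).1 (h1 w hw)
        rw [← this]
      · rintro ⟨ρ', σ⟩ hx ⟨ρ'', σ'⟩ hx' h
        simp only [Finset.mem_filter, Finset.mem_univ, true_and] at hx hx' h
        rw [hx.2, hx'.2, h]
      · intro σ hσ
        simp only [Finset.mem_filter, Finset.mem_univ, true_and] at hσ
        refine ⟨(ρ, σ), ?_, rfl⟩
        simp only [Finset.mem_filter, Finset.mem_univ, true_and, and_true]
        intro w hw
        rw [psi_eq_iff]
        exact Prod.ext (hσ w hw) (hρ w hw).symm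
    · intro w hw w' hw' h h2
      apply hu hw hw'
      have h3 : φ (ρ (u w).1, (u w).2) = φ (ρ (u w').1, (u w').2) :=
        Prod.ext h (by rw [hρ w hw, hρ w' hw', h2])
      have h4 := φ.injective h3
      simp only [Prod.mk.injEq, EmbeddingLike.apply_eq_iff_eq] at h4
      exact Prod.ext h4.1 h4.2
  · rintro ⟨ρ, σ⟩ hx
    simp only [Finset.coe_filter, Finset.mem_univ, true_and, Set.mem_ofPred_eq] at hx ⊢
    rw [hadm]
    intro w hw
    have := (psi_eq_iff _ _ _ _ _).1 (hx w hw)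
    rw [← this]
end psi

abbrev Slot (k : ℕ) := Fin (2 * k + 1) × Bool

abbrev PIdx (k : ℕ) := Equiv.Perm (Fin (2 * k + 1)) × (Bool → Equiv.Perm (Fin (2 * k + 1)))

/-- restriction of a map to `W`, extended by the identity -/
def restr {Y : Type} [DecidableEq Y] (W : Finset Y) (ψ : Y → Y) : Y → Y :=
  fun w => if w ∈ W then ψ w else w

open Classical in
/-- counting polynomial -/
noncomputable def polU (k : ℕ) (W : Finset (Slot k)) (u : Slot k → Slot k) : Polynomial ℝ :=
  if Set.InjOn u W ∧ ∀ w ∉ W, u w = w then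
    Polynomial.C ((fixCount2 W : ℝ) * fixCount (W.image (fun w => (u w).1))) *
      cnt ((W.image (fun w => (u w).1)).toList.map (Adm W u)) (nP k)
  else 0

lemma polU_natDegree (k : ℕ) (W : Finset (Slot k)) (hW : W.card ≤ k) (u : Slot k → Slot k) :
    (polU k W u).natDegree ≤ k := by
  unfold polU
  split_ifs
  · refine (Polynomial.natDegree_C_mul_le _ _).trans ((cnt_natDegree _ _ (nP_natDegree k)).trans ?_)
    rw [List.length_map, Finset.length_toList]
    exact Finset.card_image_le.trans hW
  · simp

lemma polU_eval (k j : ℕ) (φ : Equiv.Perm (Slot k))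
    (hφ : ∀ t, (((Finset.univ : Finset (Fin (2 * k + 1))).filter (fun p => ptyp φ p = t)).card : ℝ)
      = (nP k t).eval (j : ℝ)) (W : Finset (Slot k)) (u : Slot k → Slot k) :
    ((Finset.univ.filter (fun x : PIdx k => restr W (psi φ x.1 x.2) = u)).card : ℝ)
      = (polU k W u).eval (j : ℝ) := by
  have hr : ∀ ψ : Slot k → Slot k, restr W ψ = u ↔ (∀ w ∈ W, ψ w = u w) ∧ ∀ w ∉ W, u w = w := by
    intro ψ
    constructor
    · rintro rfl
      exact ⟨fun w hw => by simp [restr, hw], fun w hw => by simp [restr, hw]⟩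
    · rintro ⟨h1, h2⟩
      funext w
      by_cases hw : w ∈ W
      · simp [restr, hw, h1]
      · simp [restr, hw, h2]
  unfold polU
  split_ifs with h
  · have := count_u φ W u h.1
    have hf : (Finset.univ.filter (fun x : PIdx k => restr W (psi φ x.1 x.2) = u))
        = Finset.univ.filter (fun x : PIdx k => ∀ w ∈ W, psi φ x.1 x.2 w = u w) :=
      Finset.filter_congr fun x _ => by rw [hr]; exact and_iff_left h.2
    rw [hf, this, Polynomial.eval_mul, Polynomial.eval_C]
    congr 1
    rw [← Polynomial.coe_evalRingHom, cnt_map]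
    congr 1
    funext t
    exact hφ t
  · rw [Polynomial.eval_zero, Nat.cast_eq_zero, Finset.card_eq_zero]
    ext x
    simp only [Finset.mem_filter, Finset.mem_univ, true_and, Finset.notMem_empty, iff_false, hr]
    rintro ⟨h1, h2⟩
    refine h ⟨?_, h2⟩
    intro w hw w' hw' he
    rw [← h1 w hw, ← h1 w' hw'] at he
    exact (psi φ x.1 x.2).injective he

lemma nP_half (k : ℕ) (t : Bool → Bool) :
    (nP k t).eval (-1 / 2) = if t = (fun _ => true) ∨ t = (fun _ => false) then (k : ℝ) + 1 / 2 else 0 := by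
  have hn1 : (fun _ : Bool => true) ≠ id := fun h => by simpa using congrFun h false
  have hn2 : (fun _ : Bool => false) ≠ id := fun h => by simpa using congrFun h true
  unfold nP
  by_cases h1 : t = id
  · subst h1
    simp [hn1.symm, hn2.symm]
    norm_num
  · by_cases h2 : t = (fun _ => true) ∨ t = (fun _ => false)
    · rw [if_neg h1, if_pos h2, if_pos h2]
      simp; ring
    · rw [if_neg h1, if_neg h2, if_neg h2]; simp

lemma polU_half_nonneg (k : ℕ) (W : Finset (Slot k)) (hW : W.card ≤ k) (u : Slot k → Slot k) :
    0 ≤ (polU k W u).eval (-1 / 2) := by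
  unfold polU
  split_ifs
  · rw [Polynomial.eval_mul, Polynomial.eval_C]
    apply mul_nonneg (by positivity)
    rw [← Polynomial.coe_evalRingHom, cnt_map]
    apply cnt_nonneg
    intro t
    rw [Polynomial.coe_evalRingHom, nP_half]
    split_ifs
    · right
      rw [List.length_map, Finset.length_toList]
      have h1 : (W.image (fun w => (u w).1)).card ≤ k := Finset.card_image_le.trans hW
      have h2 : ((W.image (fun w => (u w).1)).card : ℝ) ≤ k := by exact_mod_cast h1
      linarith
    · left; rfl
  · simp

theorem pseudo (k : ℕ) (hk : 2 ≤ k) :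
    ∃ (a : Fin (k + 1) × PIdx k → ℝ) (ψ : Fin (k + 1) × PIdx k → Equiv.Perm (Slot k)),
      ∑ ω, a ω = 1 ∧
      (∀ W : Finset (Slot k), W.card ≤ k → ∀ F : Equiv.Perm (Slot k) → ℝ, (∀ τ, 0 ≤ F τ) →
        (∀ τ τ', (∀ w ∈ W, τ w = τ' w) → F τ = F τ') → 0 ≤ ∑ ω, a ω * F (ψ ω)) ∧
      (∀ i i', ∑ ω, a ω * (if (ψ ω (i, true)).1 = (ψ ω (i', false)).1 then 1 else 0) = 0) := by
  classical
  obtain ⟨a0, ha0⟩ := lagrange_functional k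
  have hb : ∀ j : Fin (k + 1), ∃ φ : Equiv.Perm (Slot k), ∀ t,
      (((Finset.univ : Finset (Fin (2 * k + 1))).filter (fun p => ptyp φ p = t)).card : ℝ)
      = (nP k t).eval ((j : ℕ) : ℝ) := fun j => exists_base k j (by omega)
  choose φ hφ using hb
  set M : ℝ := (Fintype.card (PIdx k) : ℝ) with hM
  have hMpos : 0 < M := by
    rw [hM]; exact_mod_cast Fintype.card_pos
  have key : ∀ W : Finset (Slot k), W.card ≤ k → ∀ F' : (Slot k → Slot k) → ℝ,
      ∑ ω : Fin (k + 1) × PIdx k, (a0 ω.1 * M⁻¹) * F' (restr W (psi (φ ω.1) ω.2.1 ω.2.2))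
        = ∑ u, M⁻¹ * F' u * (polU k W u).eval (-1 / 2) := by
    intro W hW F'
    rw [Fintype.sum_prod_type]
    have h1 : ∀ j : Fin (k + 1), ∑ x : PIdx k, (a0 j * M⁻¹) * F' (restr W (psi (φ j) x.1 x.2))
        = ∑ u, M⁻¹ * F' u * (a0 j * (polU k W u).eval ((j : ℕ) : ℝ)) := by
      intro j
      rw [← Finset.mul_sum, ← Finset.sum_fiberwise (s := Finset.univ)
        (g := fun x : PIdx k => restr W (psi (φ j) x.1 x.2)), Finset.mul_sum]
      refine Finset.sum_congr rfl fun u _ => ?_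
      rw [← polU_eval k j (φ j) (hφ j) W u]
      have : ∀ x ∈ Finset.univ.filter (fun x : PIdx k => restr W (psi (φ j) x.1 x.2) = u),
          F' (restr W (psi (φ j) x.1 x.2)) = F' u := fun x hx => by
        rw [(Finset.mem_filter.1 hx).2]
      rw [Finset.sum_congr rfl this, Finset.sum_const, nsmul_eq_mul]
      ring
    simp only [h1]
    rw [Finset.sum_comm]
    refine Finset.sum_congr rfl fun u _ => ?_
    rw [← Finset.mul_sum, ha0 _ (polU_natDegree k W hW u)]
  refine ⟨fun ω => a0 ω.1 * M⁻¹, fun ω => psi (φ ω.1) ω.2.1 ω.2.2, ?_, ?_, ?_⟩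
  · rw [Fintype.sum_prod_type]
    simp only [Finset.sum_const, Finset.card_univ, nsmul_eq_mul, ← hM]
    have := ha0 1 (by simp)
    simp only [Polynomial.eval_one, mul_one] at this
    rw [← this]
    refine Finset.sum_congr rfl fun j _ => ?_
    field_simp
  · intro W hW F hF hdep
    let F' : (Slot k → Slot k) → ℝ := fun u =>
      if h : ∃ τ : Equiv.Perm (Slot k), restr W τ = u then F h.choose else 0
    have hF' : ∀ τ : Equiv.Perm (Slot k), F τ = F' (restr W τ) := by
      intro τ
      have h : ∃ τ' : Equiv.Perm (Slot k), restr W τ' = restr W τ := ⟨τ, rfl⟩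
      simp only [F', dif_pos h]
      apply hdep
      intro w hw
      have := congrFun h.choose_spec w
      simp only [restr, hw, if_true] at this
      exact this.symm
    simp only [hF']
    rw [key W hW F']
    apply Finset.sum_nonneg
    intro u _
    refine mul_nonneg (mul_nonneg (inv_nonneg.2 hMpos.le) ?_) (polU_half_nonneg k W hW u)
    simp only [F']
    split_ifs
    · exact hF _
    · exact le_rfl
  · intro i i'
    let W : Finset (Slot k) := {(i, true), (i', false)}
    have hW : W.card ≤ k := (Finset.card_le_two).trans hk
    have := key W hW (fun u => if (u (i, true)).1 = (u (i', false)).1 then 1 else 0)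
    simp only [restr, W, Finset.mem_insert, Finset.mem_singleton, true_or, or_true, if_true] at this
    rw [this]
    apply Finset.sum_eq_zero
    intro u _
    split_ifs with he
    · have : (polU k W u).eval (-1 / 2) = 0 := by
        unfold polU
        split_ifs with h
        · have hS : W.image (fun w => (u w).1) = {(u (i, true)).1} := by
            simp [W, Finset.image_insert, ← he]
          rw [hS, Finset.toList_singleton, Polynomial.eval_mul, ← Polynomial.coe_evalRingHom,
            cnt_map]
          simp only [List.map_cons, List.map_nil, cnt, mul_one]
          rw [Finset.sum_eq_zero, mul_zero]
          intro t ht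
          simp only [Adm, Finset.mem_filter, Finset.mem_univ, true_and] at ht
          have h1 := ht (i, true) (by simp [W]) rfl
          have h2 := ht (i', false) (by simp [W]) he.symm
          rw [Polynomial.coe_evalRingHom, nP_half, if_neg]
          rintro (rfl | rfl)
          · simp at h2
          · simp at h1
        · simp
      rw [this, mul_zero]
    · simp

/-! ### Cycles and the separating inequality -/

lemma rot_val {ℓ : ℕ} (q : Fin ℓ) :
    ((finRotate ℓ q : Fin ℓ) : ℕ) = if (q : ℕ) + 1 = ℓ then 0 else (q : ℕ) + 1 := by
  rcases ℓ with _ | ℓ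
  · exact q.elim0
  · rw [finRotate_apply, Fin.val_add_one]
    by_cases h : q = Fin.last ℓ
    · subst h; simp
    · rw [if_neg h, if_neg]
      intro h'
      apply h
      apply Fin.ext
      rw [Fin.val_last]; omega

lemma rot_ne {ℓ : ℕ} (hℓ : 3 ≤ ℓ) (q : Fin ℓ) : finRotate ℓ q ≠ q := by
  intro h
  have := rot_val q
  rw [h] at this
  split_ifs at this <;> omega

lemma rot_rot_ne {ℓ : ℕ} (hℓ : 3 ≤ ℓ) (q : Fin ℓ) : finRotate ℓ (finRotate ℓ q) ≠ q := by
  intro h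
  have h1 := rot_val (finRotate ℓ q)
  have h2 := rot_val q
  have h3 := q.2
  rw [h] at h1
  split_ifs at h1 h2 <;> omega

/-- adjacency in a cycle -/
def cadj {n ℓ : ℕ} (f : Fin ℓ → Fin n) (v w : Fin n) : Prop :=
  ∃ a : Fin ℓ, s(f a, f (finRotate ℓ a)) = s(v, w)

lemma cadj_symm {n ℓ : ℕ} {f : Fin ℓ → Fin n} {v w : Fin n} (h : cadj f v w) : cadj f w v := by
  obtain ⟨a, ha⟩ := h
  exact ⟨a, ha.trans Sym2.eq_swap⟩

lemma cadj_iff {n ℓ : ℕ} {f : Fin ℓ → Fin n} (hf : Function.Injective f) (q : Fin ℓ) (w : Fin n) :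
    cadj f (f q) w ↔ w = f (finRotate ℓ q) ∨ w = f ((finRotate ℓ).symm q) := by
  constructor
  · rintro ⟨a, ha⟩
    rw [Sym2.eq_iff] at ha
    rcases ha with ⟨h1, h2⟩ | ⟨h1, h2⟩
    · left; rw [← h2, hf h1]
    · right
      rw [← h1, ← hf h2, Equiv.symm_apply_apply]
  · rintro (rfl | rfl)
    · exact ⟨q, rfl⟩
    · refine ⟨(finRotate ℓ).symm q, ?_⟩
      rw [Equiv.apply_symm_apply]
      exact Sym2.eq_swap

lemma cadj_left {n ℓ : ℕ} {f : Fin ℓ → Fin n} {v w : Fin n} (h : cadj f v w) : ∃ q, v = f q := by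
  obtain ⟨a, ha⟩ := h
  rw [Sym2.eq_iff] at ha
  rcases ha with ⟨h1, _⟩ | ⟨_, h2⟩
  · exact ⟨a, h1.symm⟩
  · exact ⟨_, h2.symm⟩

open Classical in
/-- evaluation at an edge -/
noncomputable def evL {n : ℕ} (v w : Fin n) : (Edge n → ℝ) →ₗ[ℝ] ℝ :=
  if h : v ≠ w then LinearMap.proj (⟨s(v, w), by simpa using h⟩ : Edge n) else 0

open Classical in
lemma evL_cycleVec {n ℓ : ℕ} (f : Fin ℓ → Fin n) (v w : Fin n) (hvw : v ≠ w) :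
    evL v w (cycleVec f) = if cadj f v w then 1 else 0 := by
  unfold evL
  rw [dif_pos hvw]
  simp only [LinearMap.proj_apply, cycleVec, Finset.mem_image, Finset.mem_univ, true_and, cadj]
  congr

lemma evL_cycleVec_nonneg {n ℓ : ℕ} (f : Fin ℓ → Fin n) (v w : Fin n) :
    0 ≤ evL v w (cycleVec f) := by
  classical
  by_cases h : v = w
  · simp [evL, h]
  · rw [evL_cycleVec f v w h]; split_ifs <;> norm_num

lemma evL_cycleVec_le {n ℓ : ℕ} (f : Fin ℓ → Fin n) (v w : Fin n) :
    evL v w (cycleVec f) ≤ 1 := by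
  classical
  by_cases h : v = w
  · simp [evL, h]
  · rw [evL_cycleVec f v w h]; split_ifs <;> norm_num

open Classical in
/-- the separating functional -/
noncomputable def sepL {n m : ℕ} (A A' : Fin m → Fin n) : (Edge n → ℝ) →ₗ[ℝ] ℝ :=
  ∑ i, (evL (A i) (A' i) -
    ∑ w ∈ (Finset.univ : Finset (Fin n)).filter (fun w => (∀ j, w ≠ A j) ∧ w ≠ A' i), evL (A i) w)

lemma sepL_lt {n m ℓ : ℕ} (hℓ : 3 ≤ ℓ) (hm : Odd m) (A A' : Fin m → Fin n)
    (hA : Function.Injective A) (hAA : ∀ i j, A i ≠ A' j) (f : Fin ℓ → Fin n)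
    (hf : Function.Injective f) : sepL A A' (cycleVec f) < m := by
  classical
  by_contra hcon
  push Not at hcon
  set T : Fin m → ℝ := fun i => evL (A i) (A' i) (cycleVec f) -
    ∑ w ∈ (Finset.univ : Finset (Fin n)).filter (fun w => (∀ j, w ≠ A j) ∧ w ≠ A' i),
      evL (A i) w (cycleVec f) with hT
  have hL : sepL A A' (cycleVec f) = ∑ i, T i := by
    simp [sepL, hT, LinearMap.sum_apply]
  have hnn : ∀ i, 0 ≤ ∑ w ∈ (Finset.univ : Finset (Fin n)).filter
      (fun w => (∀ j, w ≠ A j) ∧ w ≠ A' i), evL (A i) w (cycleVec f) := fun i =>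
    Finset.sum_nonneg fun w _ => evL_cycleVec_nonneg f _ _
  have hT1 : ∀ i, T i ≤ 1 := fun i => by
    have h1 := hnn i
    have h2 := evL_cycleVec_le f (A i) (A' i)
    simp only [hT]; linarith
  have hTeq : ∀ i, T i = 1 := by
    have : ∑ i, T i = ∑ i : Fin m, (1 : ℝ) := by
      apply le_antisymm
      · exact Finset.sum_le_sum fun i _ => hT1 i
      · simpa [← hL] using hcon
    have := (Finset.sum_eq_sum_iff_of_le (fun i _ => hT1 i)).1 this
    exact fun i => this i (Finset.mem_univ _)
  have hadj : ∀ i, cadj f (A i) (A' i) ∧ ∀ w, (∀ j, w ≠ A j) → w ≠ A' i → ¬ cadj f (A i) w := by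
    intro i
    have h0 := hTeq i
    have h1 := hnn i
    have h2 := evL_cycleVec_le f (A i) (A' i)
    simp only [hT] at h0
    have h3 : evL (A i) (A' i) (cycleVec f) = 1 := by linarith
    have h4 : ∑ w ∈ (Finset.univ : Finset (Fin n)).filter
      (fun w => (∀ j, w ≠ A j) ∧ w ≠ A' i), evL (A i) w (cycleVec f) = 0 := by linarith
    rw [Finset.sum_eq_zero_iff_of_nonneg (fun w _ => evL_cycleVec_nonneg f _ _)] at h4
    refine ⟨?_, ?_⟩
    · by_contra hc
      rw [evL_cycleVec f _ _ (hAA i i), if_neg hc] at h3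
      norm_num at h3
    · intro w hw1 hw2 hc
      have := h4 w (by simp only [Finset.mem_filter, Finset.mem_univ, true_and]; exact ⟨hw1, hw2⟩)
      rw [evL_cycleVec f _ _ (hw1 i).symm, if_pos hc] at this
      norm_num at this
  have hg : ∀ i, ∃ i', i' ≠ i ∧ cadj f (A i) (A i') ∧
      ∀ w, cadj f (A i) w → w = A' i ∨ w = A i' := by
    intro i
    obtain ⟨h1, h2⟩ := hadj i
    obtain ⟨q, hq⟩ := cadj_left h1
    have hother : ∃ o, cadj f (A i) (f o) ∧ f o ≠ A i ∧ f o ≠ A' i ∧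
        ∀ w, cadj f (A i) w → w = A' i ∨ w = f o := by
      have hne : (finRotate ℓ).symm q ≠ q := fun h => by
        have := rot_ne hℓ q
        rw [Equiv.symm_apply_eq] at h
        exact this h.symm
      have hne2 : finRotate ℓ q ≠ (finRotate ℓ).symm q := fun h => by
        rw [Equiv.eq_symm_apply] at h
        exact rot_rot_ne hℓ q h
      rw [hq] at h1 ⊢
      rw [cadj_iff hf] at h1
      simp only [cadj_iff hf]
      rcases h1 with h1 | h1
      · refine ⟨(finRotate ℓ).symm q, Or.inr rfl, hf.ne hne, ?_, ?_⟩
        · rw [h1]; exact hf.ne hne2.symm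
        · rw [h1]; exact fun w h => h
      · refine ⟨finRotate ℓ q, Or.inl rfl, hf.ne (rot_ne hℓ q), ?_, ?_⟩
        · rw [h1]; exact hf.ne hne2
        · rw [h1]; exact fun w h => h.symm
    obtain ⟨o, ho1, ho2, ho3, ho4⟩ := hother
    have : ∃ j, f o = A j := by
      by_contra hc
      push Not at hc
      exact h2 (f o) hc ho3 ho1
    obtain ⟨i', hi'⟩ := this
    rw [hi'] at ho1 ho2 ho4
    exact ⟨i', fun h => ho2 (by rw [h]), ho1, ho4⟩
  choose g hg1 hg2 hg3 using hg
  have hinv : ∀ i, g (g i) = i := by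
    intro i
    rcases hg3 (g i) (A i) (cadj_symm (hg2 i)) with h | h
    · exact absurd h (hAA _ _)
    · exact (hA h).symm
  have hsum : ∑ i : Fin m, (1 : ZMod 2) = 0 :=
    Finset.sum_involution (fun i _ => g i) (fun i _ => by decide) (fun i _ _ => hg1 i)
      (fun i _ => Finset.mem_univ _) (fun i _ => hinv i)
  simp only [Finset.sum_const, Finset.card_univ, Fintype.card_fin, nsmul_eq_mul, mul_one] at hsum
  rw [ZMod.natCast_eq_zero_iff_even] at hsum
  exact (Nat.not_even_iff_odd.2 hm) hsum

lemma not_mem_cyclePolytope {n m ℓ : ℕ} (hℓ : 3 ≤ ℓ) (hm : Odd m) (A A' : Fin m → Fin n)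
    (hA : Function.Injective A) (hAA : ∀ i j, A i ≠ A' j) (z : Edge n → ℝ)
    (hz : (m : ℝ) ≤ sepL A A' z) : z ∉ cyclePolytope n ℓ := by
  intro h
  have hsub : cyclePolytope n ℓ ⊆ {w | sepL A A' w < m} := by
    apply convexHull_min
    · rintro x ⟨f, hf, rfl⟩
      exact sepL_lt hℓ hm A A' hA hAA f hf
    · exact convex_halfSpace_lt (sepL A A').isLinear _
  have := hsub h
  exact absurd hz (not_le.2 this)

/-! ### Placing matchings on cycles -/

/-- position on the cycle -/
def posN {k : ℕ} (s : Slot k × Bool) : ℕ :=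
  4 * (s.1.1 : ℕ) + (if s.1.2 then (if s.2 then 3 else 2) else (if s.2 then 0 else 1))

lemma posN_lt {k : ℕ} (s : Slot k × Bool) : posN s < 4 * (2 * k + 1) := by
  obtain ⟨⟨p, e⟩, b⟩ := s
  have := p.2
  cases e <;> cases b <;> simp [posN] <;> omega

lemma posN_inj {k : ℕ} {s s' : Slot k × Bool} (h : posN s = posN s') : s = s' := by
  obtain ⟨⟨p, e⟩, b⟩ := s
  obtain ⟨⟨p', e'⟩, b'⟩ := s'
  have key : (p : ℕ) = p' ∧ e = e' ∧ b = b' := by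
    cases e <;> cases b <;> cases e' <;> cases b' <;> simp [posN] at h ⊢ <;> omega
  obtain ⟨h1, rfl, rfl⟩ := key
  rw [Fin.ext h1]

section place
variable {n ℓ k : ℕ} (h4 : 4 * (2 * k + 1) ≤ ℓ) (hn : ℓ ≤ n)

def slotPos (s : Slot k × Bool) : Fin ℓ := ⟨posN s, (posN_lt s).trans_le h4⟩

def embN : Slot k × Bool ↪ Fin n :=
  ⟨fun s => Fin.castLE hn (slotPos h4 s), fun s s' h => by
    have h1 := Fin.castLE_injective hn h
    simp only [slotPos, Fin.mk.injEq] at h1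
    exact posN_inj h1⟩

noncomputable def Phi (τ : Equiv.Perm (Slot k)) : Equiv.Perm (Fin n) :=
  Equiv.Perm.viaEmbedding (Equiv.prodCongrLeft (fun _ : Bool => τ)) (embN h4 hn)

lemma Phi_apply (τ : Equiv.Perm (Slot k)) (y : Slot k) (b : Bool) :
    Phi h4 hn τ (embN h4 hn (y, b)) = embN h4 hn (τ y, b) := by
  unfold Phi
  rw [Equiv.Perm.viaEmbedding_apply]
  rfl

lemma Phi_notMem (τ : Equiv.Perm (Slot k)) (v : Fin n) (hv : v ∉ Set.range (embN h4 hn)) :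
    Phi h4 hn τ v = v :=
  Equiv.Perm.viaEmbedding_apply_of_notMem _ _ _ hv

lemma Phi_mul (τ τ' : Equiv.Perm (Slot k)) : Phi h4 hn (τ * τ') = Phi h4 hn τ * Phi h4 hn τ' := by
  ext v
  by_cases hv : v ∈ Set.range (embN h4 hn)
  · obtain ⟨⟨y, b⟩, rfl⟩ := hv
    rw [Equiv.Perm.mul_apply, Phi_apply, Phi_apply, Phi_apply, Equiv.Perm.mul_apply]
  · rw [Equiv.Perm.mul_apply, Phi_notMem _ _ _ _ hv, Phi_notMem _ _ _ _ hv, Phi_notMem _ _ _ _ hv]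

lemma Phi_sign (τ : Equiv.Perm (Slot k)) : Equiv.Perm.sign (Phi h4 hn τ) = 1 := by
  classical
  unfold Phi Equiv.Perm.viaEmbedding
  rw [Equiv.Perm.sign_extendDomain, Equiv.Perm.sign_prodCongrLeft]
  simp only [Finset.prod_const, Finset.card_univ, Fintype.card_bool]
  exact Int.units_sq _

/-- cycle with the nodes of the pairs placed according to the slot-to-node map `τ` -/
noncomputable def cyc (τ : Equiv.Perm (Slot k)) : Fin ℓ ↪ Fin n := Phi h4 hn τ • Fin.castLEEmb hn

lemma cyc_slotPos (τ : Equiv.Perm (Slot k)) (y : Slot k) (b : Bool) :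
    cyc h4 hn τ (slotPos h4 (y, b)) = embN h4 hn (τ y, b) := by
  rw [← Phi_apply]; rfl

lemma cyc_mul (τ τ' : Equiv.Perm (Slot k)) : cyc h4 hn (τ * τ') = Phi h4 hn τ • cyc h4 hn τ' := by
  unfold cyc
  rw [Phi_mul, mul_smul]

lemma cyc_adj (τ : Equiv.Perm (Slot k)) (p : Fin (2 * k + 1)) (e : Bool) (w : Fin n) :
    cadj (cyc h4 hn τ) (embN h4 hn (τ (p, e), false)) w ↔
      w = embN h4 hn (τ (p, e), true) ∨ w = embN h4 hn (τ (p, !e), false) := by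
  rw [← cyc_slotPos, cadj_iff (cyc h4 hn τ).injective, ← cyc_slotPos, ← cyc_slotPos]
  have hp := p.2
  cases e
  · have h1 : finRotate ℓ (slotPos h4 ((p, false), false)) = slotPos h4 ((p, true), false) := by
      apply Fin.ext
      rw [rot_val]
      simp only [slotPos, posN, Bool.false_eq_true, if_true, if_false]
      split_ifs <;> omega
    have h2 : (finRotate ℓ).symm (slotPos h4 ((p, false), false)) = slotPos h4 ((p, false), true) := by
      rw [Equiv.symm_apply_eq]
      apply Fin.ext
      rw [rot_val]
      simp only [slotPos, posN, Bool.false_eq_true, if_true, if_false]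
      split_ifs <;> omega
    rw [h1, h2, Bool.not_false]
    exact or_comm
  · have h1 : finRotate ℓ (slotPos h4 ((p, true), false)) = slotPos h4 ((p, true), true) := by
      apply Fin.ext
      rw [rot_val]
      simp only [slotPos, posN, Bool.false_eq_true, if_true, if_false]
      split_ifs <;> omega
    have h2 : (finRotate ℓ).symm (slotPos h4 ((p, true), false)) = slotPos h4 ((p, false), false) := by
      rw [Equiv.symm_apply_eq]
      apply Fin.ext
      rw [rot_val]
      simp only [slotPos, posN, Bool.false_eq_true, if_true, if_false]
      split_ifs <;> omega
    rw [h1, h2, Bool.not_true]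

end place

theorem exists_separating {n ℓ k : ℕ} (hk : 2 ≤ k) (h4 : 4 * (2 * k + 1) ≤ ℓ) (hn : ℓ ≤ n)
    {ι : Type} (s : ι → (Fin ℓ ↪ Fin n) → ℝ) (hs : ∀ i x, 0 ≤ s i x)
    (hV : ∀ i, ∃ V : Finset (Fin n), V.card ≤ k ∧ ∀ τ : Equiv.Perm (Fin n),
      (∀ v ∈ V, τ v = v) → Equiv.Perm.sign τ = 1 → ∀ x, s i (τ • x) = s i x) :
    ∃ (a : Fin (k + 1) × PIdx k → ℝ) (x : Fin (k + 1) × PIdx k → (Fin ℓ ↪ Fin n)),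
      ∑ ω, a ω = 1 ∧ (∀ i, 0 ≤ ∑ ω, a ω * s i (x ω)) ∧
      ∑ ω, a ω • cycleVec (x ω) ∉ cyclePolytope n ℓ := by
  classical
  obtain ⟨a, ψ, ha, hpos, hcross⟩ := pseudo k hk
  refine ⟨a, fun ω => cyc h4 hn (ψ ω)⁻¹, ha, ?_, ?_⟩
  · intro i
    obtain ⟨V, hVc, hVi⟩ := hV i
    let W : Finset (Slot k) := Finset.univ.filter (fun y => ∃ b, embN h4 hn (y, b) ∈ V)
    have hmemW : ∀ y, y ∈ W ↔ ∃ b, embN h4 hn (y, b) ∈ V := fun y => by simp [W]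
    have hW : W.card ≤ k := by
      refine le_trans ?_ hVc
      have : ∀ y, ∃ b, y ∈ W → embN h4 hn (y, b) ∈ V := by
        intro y
        by_cases hy : y ∈ W
        · obtain ⟨b, hb⟩ := (hmemW y).1 hy
          exact ⟨b, fun _ => hb⟩
        · exact ⟨true, fun h => absurd h hy⟩
      choose b hb using this
      refine Finset.card_le_card_of_injOn (fun y => embN h4 hn (y, b y)) (fun y hy => hb y hy) ?_
      intro y _ y' _ h
      have := (embN h4 hn).injective h
      exact (Prod.mk.inj this).1
    refine hpos W hW (fun τ => s i (cyc h4 hn τ⁻¹)) (fun τ => hs _ _) ?_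
    intro τ τ' h
    have e : cyc h4 hn τ'⁻¹ = Phi h4 hn (τ'⁻¹ * τ) • cyc h4 hn τ⁻¹ := by
      rw [← cyc_mul]; congr 1; group
    rw [e, hVi _ _ (Phi_sign h4 hn _)]
    intro v hv
    by_cases hr : v ∈ Set.range (embN h4 hn)
    · obtain ⟨⟨y, b⟩, rfl⟩ := hr
      rw [Phi_apply, Equiv.Perm.mul_apply, h y ((hmemW y).2 ⟨b, hv⟩), perm_inv_apply]
    · exact Phi_notMem h4 hn _ v hr
  · apply not_mem_cyclePolytope (m := 2 * k + 1) (by omega) ⟨k, rfl⟩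
      (fun i => embN h4 hn ((i, true), false)) (fun i => embN h4 hn ((i, true), true))
    · intro i j h
      have := (embN h4 hn).injective h
      simpa using this
    · intro i j h
      have := (embN h4 hn).injective h
      simp at this
    · have hadj : ∀ ω (y : Slot k) (w : Fin n), cadj (cyc h4 hn (ψ ω)⁻¹) (embN h4 hn (y, false)) w ↔
          w = embN h4 hn (y, true) ∨
          w = embN h4 hn ((ψ ω)⁻¹ ((ψ ω y).1, !(ψ ω y).2), false) := by
        intro ω y w
        have := cyc_adj h4 hn (ψ ω)⁻¹ (ψ ω y).1 (ψ ω y).2 w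
        rw [Prod.mk.eta, perm_inv_apply] at this
        exact this
      have hA1 : ∀ i : Fin (2 * k + 1), evL (embN h4 hn ((i, true), false)) (embN h4 hn ((i, true), true))
          (∑ ω, a ω • cycleVec (cyc h4 hn (ψ ω)⁻¹)) = 1 := by
        intro i
        have hne : embN h4 hn ((i, true), false) ≠ embN h4 hn ((i, true), true) :=
          (embN h4 hn).injective.ne (by simp)
        rw [map_sum, ← ha]
        refine Finset.sum_congr rfl fun ω _ => ?_
        rw [map_smul, evL_cycleVec _ _ _ hne, if_pos, smul_eq_mul, mul_one]
        rw [hadj]; left; rfl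
      have hA2 : ∀ i : Fin (2 * k + 1), ∀ w : Fin n, (∀ j, w ≠ embN h4 hn ((j, true), false)) →
          w ≠ embN h4 hn ((i, true), true) → evL (embN h4 hn ((i, true), false)) w
          (∑ ω, a ω • cycleVec (cyc h4 hn (ψ ω)⁻¹)) = 0 := by
        intro i w hw1 hw2
        rw [map_sum]
        by_cases hB : ∃ i', w = embN h4 hn ((i', false), false)
        · obtain ⟨i', rfl⟩ := hB
          rw [← hcross i i']
          refine Finset.sum_congr rfl fun ω _ => ?_
          rw [map_smul, evL_cycleVec _ _ _ (hw1 i).symm, smul_eq_mul]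
          congr 1
          have : cadj (cyc h4 hn (ψ ω)⁻¹) (embN h4 hn ((i, true), false)) (embN h4 hn ((i', false), false))
              ↔ (ψ ω (i, true)).1 = (ψ ω (i', false)).1 := by
            rw [hadj]
            rw [(embN h4 hn).injective.eq_iff, (embN h4 hn).injective.eq_iff]
            simp only [Prod.mk.injEq, Bool.false_eq_true, and_false, false_or, and_true]
            rw [Equiv.Perm.eq_inv_iff_eq]
            constructor
            · intro h; rw [h]
            · intro h
              have hne : ψ ω (i, true) ≠ ψ ω (i', false) := (ψ ω).injective.ne (by simp)
              refine Prod.ext h.symm ?_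
              have h2 : (ψ ω (i, true)).2 ≠ (ψ ω (i', false)).2 := fun h2 => hne (Prod.ext h h2)
              show (ψ ω (i', false)).2 = !(ψ ω (i, true)).2
              revert h2
              generalize (ψ ω (i, true)).2 = c
              generalize (ψ ω (i', false)).2 = c'
              revert c c'; decide
          simp only [this]
        · apply Finset.sum_eq_zero
          intro ω _
          rw [map_smul, evL_cycleVec _ _ _ (hw1 i).symm, if_neg, smul_zero]
          rw [hadj]
          rintro (h | h)
          · exact hw2 h
          · generalize (ψ ω)⁻¹ ((ψ ω (i, true)).1, !(ψ ω (i, true)).2) = y at h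
            obtain ⟨j, e⟩ := y
            cases e
            · exact hB ⟨j, h⟩
            · exact hw1 j h
      apply le_of_eq
      unfold sepL
      rw [LinearMap.sum_apply]
      have : ∀ i : Fin (2 * k + 1), (evL (embN h4 hn ((i, true), false)) (embN h4 hn ((i, true), true)) -
        ∑ w ∈ (Finset.univ : Finset (Fin n)).filter
          (fun w => (∀ j, w ≠ embN h4 hn ((j, true), false)) ∧ w ≠ embN h4 hn ((i, true), true)),
          evL (embN h4 hn ((i, true), false)) w) (∑ ω, a ω • cycleVec (cyc h4 hn (ψ ω)⁻¹)) = 1 := by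
        intro i
        rw [LinearMap.sub_apply, hA1, LinearMap.sum_apply, Finset.sum_eq_zero, sub_zero]
        intro w hw
        simp only [Finset.mem_filter, Finset.mem_univ, true_and] at hw
        exact hA2 i w hw.1 hw.2
      rw [Finset.sum_congr rfl (fun i _ => this i)]
      simp

/-- Theorem 5.1.  There is a constant `C' > 0` such that for all `n`
and `42 ≤ ℓ ≤ n`, every extension of `P_cycl(ℓ,n)` that is isometry-symmetric with
respect to `S_n` has size at least `C'·binomial(⌊n/3⌋, ⌊(⌊ℓ/6⌋−1)/2⌋)`: whenever such a
symmetric extension `Q` is the solution set of a system of linear equations together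
with `f` linear inequalities, then `f ≥ C'·binomial(⌊n/3⌋, ⌊(⌊ℓ/6⌋−1)/2⌋)`. -/
theorem statement15 :
    ∃ C' : ℝ, 0 < C' ∧
      ∀ n ℓ d g f : ℕ, 42 ≤ ℓ → ℓ ≤ n →
        ∀ (Aeq : Fin g → Fin d → ℝ) (beq : Fin g → ℝ)
          (A : Fin f → Fin d → ℝ) (b : Fin f → ℝ)
          (Q : Set (Fin d → ℝ)),
          Q = {y : Fin d → ℝ |
              (∀ i : Fin g, ∑ j, Aeq i j * y j = beq i) ∧
              (∀ i : Fin f, ∑ j, A i j * y j ≤ b i)} →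
          ∀ p : (Fin d → ℝ) →ᵃ[ℝ] (Edge n → ℝ),
            p '' Q = cyclePolytope n ℓ →
            (∀ π : Equiv.Perm (Fin n),
              ∃ (U : Matrix (Fin d) (Fin d) ℝ) (u : Fin d → ℝ),
                U * U.transpose = 1 ∧
                (fun y : Fin d → ℝ => U.mulVec y + u) '' Q = Q ∧
                ∀ y ∈ Q, p (U.mulVec y + u) = edgeAction π (p y)) →
            C' * (Nat.choose (n / 3) ((ℓ / 6 - 1) / 2) : ℝ) ≤ (f : ℝ) := by
  obtain ⟨N, hN⟩ : ∃ N : ℕ, N = 40000 := ⟨_, rfl⟩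
  have hpow : (1 : ℝ) ≤ 2 ^ N := one_le_pow₀ (by norm_num)
  refine ⟨((2 : ℝ) ^ N)⁻¹, inv_pos.2 (by linarith), ?_⟩
  intro n ℓ d g f hℓ hn Aeq beq A b Q hQ p hp hsym
  by_contra hcon
  push Not at hcon
  obtain ⟨I, s, hs, hequiv, hmem⟩ := propA Aeq beq A b Q hQ p hp hsym
  obtain ⟨k, hk⟩ : ∃ k, k = (ℓ / 6 - 1) / 2 := ⟨_, rfl⟩
  rw [← hk] at hcon
  have hk3 : 3 ≤ k := by omega
  have hkℓ : 12 * k + 6 ≤ ℓ := by omega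
  have hV : ∀ i, ∃ V : Finset (Fin n), V.card ≤ k ∧ ∀ τ : Equiv.Perm (Fin n),
      (∀ v ∈ V, τ v = v) → Equiv.Perm.sign τ = 1 → ∀ x, s i (τ • x) = s i x := by
    intro i
    have hf : (1 : ℝ) ≤ f := by
      have := i.1.2
      exact_mod_cast (by omega : 1 ≤ f)
    obtain ⟨G, hG, hGi⟩ := index_stab s hequiv i
    have hcard : Fintype.card {i // i ∈ I} ≤ f := by
      rw [Fintype.card_coe]
      exact (Finset.card_le_univ I).trans (by simp)
    have hnN : 40000 ≤ n := by
      by_contra hlt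
      have h1 : (n / 3).choose k ≤ 2 ^ N := by
        refine (Nat.choose_le_two_pow _ _).trans ?_
        exact Nat.pow_le_pow_right (by norm_num) (by omega)
      have h2 : ((n / 3).choose k : ℝ) ≤ 2 ^ N := by exact_mod_cast h1
      have h3 : ((2 : ℝ) ^ N)⁻¹ * ((n / 3).choose k : ℝ) ≤ 1 := by
        rw [inv_mul_le_iff₀ (by linarith), mul_one]; exact h2
      linarith
    have hidx : G.index < (n / 3).choose k := by
      have h1 : ((2 : ℝ) ^ N)⁻¹ * ((n / 3).choose k : ℝ) ≤ ((n / 3).choose k : ℝ) :=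
        mul_le_of_le_one_left (Nat.cast_nonneg _) (inv_le_one_of_one_le₀ hpow)
      have h2 : (f : ℝ) < ((n / 3).choose k : ℝ) := lt_of_lt_of_le hcon h1
      have h3 : f < (n / 3).choose k := by exact_mod_cast h2
      omega
    obtain ⟨V, hVc, hVG⟩ := small_index hnN (by omega) G hidx
    exact ⟨V, hVc, fun τ h1 h2 => hGi τ (hVG τ h1 h2)⟩
  obtain ⟨a, x, ha, hpos, hnot⟩ := exists_separating (k := k) (by omega) (by omega) hn s hs hV
  exact hnot (hmem _ a x ha hpos)

end
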